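/- arXiv:1507.08349 — 2 statements merged into one kernel-verified Lean document; each statement's English description precedes it below -/
import Mathlib

section
/- Let X be a real-valued random variable with a pdf, finite differential entropy h(X), and finite H(⌊X⌋). Suppose a family of almost-regular quantizers q (parametrized by D > 0), with quantization regions S_i of Lebesgue measure Δ_i, satisfies the distortion constraint E[|X − q(X)|^r] ≤ D and achieves liminf_{D↓0} { H(q(X)) − R(D) } = (1/r) log( Γ(1+1/r)^r · e / (1 + 1/r) ). Then for every ϑ > 0: limsup_{D↓0} ∑_i P(X ∈ S_i) · 1{ | Δ_i^r / D − 2^r(1+r) | ≤ ϑ } = 1. -/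
open MeasureTheory Filter Set
open scoped ENNReal Topology ProbabilityTheory Pointwise

noncomputable section

/-- `N` is a norm on `ℝ^d`. -/
structure IsNorm {d : ℕ} (N : (Fin d → ℝ) → ℝ) : Prop where
  nonneg : ∀ x, 0 ≤ N x
  eq_zero_iff : ∀ x, N x = 0 ↔ x = 0
  smul : ∀ (c : ℝ) (x : Fin d → ℝ), N (c • x) = |c| * N x
  triangle : ∀ x y, N (x + y) ≤ N x + N y

/-- Lebesgue volume `V_d` of the unit ball of the norm `N`. -/
def unitBallVol {d : ℕ} (N : (Fin d → ℝ) → ℝ) : ℝ :=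
  (volume {x : Fin d → ℝ | N x ≤ 1}).toReal

/-- A (symbol-wise) quantizer: countably many disjoint Borel quantization regions `S i`
covering the space, with reconstruction values `c i`. -/
structure Quantizer (E : Type*) [MeasurableSpace E] where
  S : ℤ → Set E
  c : ℤ → E
  meas : ∀ i, MeasurableSet (S i)
  disj : Pairwise (Function.onFun Disjoint S)
  cover : ⋃ i, S i = Set.univ

/-- Expected `r`-th power distortion `E[‖X - q(X)‖^r]` of a quantizer, for a source with law `μ`
and norm `N`. -/
def Quantizer.distortion {E : Type*} [MeasurableSpace E] [Sub E] (q : Quantizer E)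
    (μ : Measure E) (N : E → ℝ) (r : ℝ) : ℝ≥0∞ :=
  ∑' i, ∫⁻ x in q.S i, ENNReal.ofReal (N (x - q.c i) ^ r) ∂μ

/-- Output entropy `H(q(X)) = -∑ pᵢ log pᵢ` of a quantizer (as an extended nonneg. real). -/
def Quantizer.entropy {E : Type*} [MeasurableSpace E] (q : Quantizer E) (μ : Measure E) : ℝ≥0∞ :=
  ∑' i, ENNReal.ofReal (Real.negMulLog (μ (q.S i)).toReal)

/-- Output entropy `H(q(X)) = -∑ pᵢ log pᵢ` of a quantizer (as a real number). -/
def Quantizer.entropyR {E : Type*} [MeasurableSpace E] (q : Quantizer E) (μ : Measure E) : ℝ :=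
  ∑' i, Real.negMulLog (μ (q.S i)).toReal

open scoped Classical in
/-- Kullback-Leibler divergence between two measures. -/
def klDiv {α : Type*} [MeasurableSpace α] (μ ν : Measure α) : ℝ≥0∞ :=
  if μ ≪ ν ∧ Integrable (fun x => Real.log (μ.rnDeriv ν x).toReal) μ
  then ENNReal.ofReal (∫ x, Real.log (μ.rnDeriv ν x).toReal ∂μ)
  else ⊤

/-- Mutual information of a joint law `π`, i.e. the KL divergence of `π` from the product of
its marginals. -/
def mutualInfo {α β : Type*} [MeasurableSpace α] [MeasurableSpace β]
    (π : Measure (α × β)) : ℝ≥0∞ :=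
  klDiv π ((π.map Prod.fst).prod (π.map Prod.snd))

/-- The rate-distortion function `R(D)`: the infimum of the mutual information `I(X; X̂)` over
all Markov kernels `P_{X̂|X}` with expected `r`-th power distortion at most `D`. -/
def RDfun {E : Type*} [MeasurableSpace E] [Sub E] (μ : Measure E) (N : E → ℝ) (r D : ℝ) :
    ℝ≥0∞ :=
  ⨅ (κ : ProbabilityTheory.Kernel E E) (_ : ProbabilityTheory.IsMarkovKernel κ)
    (_ : ∫⁻ p, ENNReal.ofReal (N (p.1 - p.2) ^ r) ∂(μ.compProd κ) ≤ ENNReal.ofReal D),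
    mutualInfo (μ.compProd κ)

/-- The smallest output entropy `R_{r,d}(D)` of a quantizer with `r`-th power distortion
at most `D`. -/
def RQfun {E : Type*} [MeasurableSpace E] [Sub E] (μ : Measure E) (N : E → ℝ) (r D : ℝ) :
    ℝ≥0∞ :=
  ⨅ (q : Quantizer E) (_ : q.distortion μ N r ≤ ENNReal.ofReal D), q.entropy μ

/-- The asymptotic excess rate `ℛ = liminf_{D ↓ 0} (R_{r,d}(D) - R(D))`. -/
def excessRate {E : Type*} [MeasurableSpace E] [Sub E] (μ : Measure E) (N : E → ℝ) (r : ℝ) :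
    ℝ :=
  Filter.liminf (fun D => (RQfun μ N r D).toReal - (RDfun μ N r D).toReal) (𝓝[>] (0:ℝ))

/-- The upper incomplete Gamma function `Γ(s, a) = ∫_a^∞ ξ^(s-1) e^(-ξ) dξ`. -/
def uGamma (s a : ℝ) : ℝ := ∫ ξ in Set.Ioi a, ξ ^ (s - 1) * Real.exp (-ξ)

/-- The part of the quantization cell `S i` within distance `ε` of the reconstruction point. -/
def Bcell {E : Type*} [MeasurableSpace E] [Sub E] (q : Quantizer E) (N : E → ℝ) (ε : ℝ)
    (i : ℤ) : Set E :=
  {x | x ∈ q.S i ∧ N (x - q.c i) ≤ ε}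


/-- The normalising constant of the generalised Gaussian density `exp (-|z|^r / (r D))`. -/
def ggConst (r D : ℝ) : ℝ := 2 * (r * D) ^ (1 / r) * Real.Gamma (1 + 1 / r)

/-- The generalised Gaussian density with `r`-th absolute moment `D`. -/
def ggPdf (r D z : ℝ) : ℝ := Real.exp (-(|z| ^ r / (r * D))) / ggConst r D

lemma ggConst_pos {r D : ℝ} (hr : 0 < r) (hD : 0 < D) : 0 < ggConst r D := by
  have := Real.Gamma_pos_of_pos (show 0 < 1 + 1 / r by positivity)
  unfold ggConst; positivity

lemma ggPdf_pos {r D : ℝ} (hr : 0 < r) (hD : 0 < D) (z : ℝ) : 0 < ggPdf r D z :=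
  div_pos (Real.exp_pos _) (ggConst_pos hr hD)

lemma measurable_ggPdf (r D : ℝ) : Measurable (ggPdf r D) := by
  unfold ggPdf; fun_prop

lemma ggPdf_le {r D : ℝ} (hr : 0 < r) (hD : 0 < D) (z : ℝ) : ggPdf r D z ≤ 1 / ggConst r D := by
  unfold ggPdf
  have := ggConst_pos hr hD
  gcongr
  rw [Real.exp_le_one_iff, neg_nonpos]
  positivity

lemma log_ggPdf {r D : ℝ} (hr : 0 < r) (hD : 0 < D) (z : ℝ) :
    Real.log (ggPdf r D z) = -(|z| ^ r / (r * D)) - Real.log (ggConst r D) := by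
  unfold ggPdf
  rw [Real.log_div (Real.exp_pos _).ne' (ggConst_pos hr hD).ne', Real.log_exp]

lemma integrable_comp_abs_of_integrableOn_Ioi {F : ℝ → ℝ} (hF : IntegrableOn F (Ioi 0)) :
    Integrable (fun x => F |x|) := by
  have h1 : Integrable ((Ioi (0 : ℝ)).indicator F) := hF.integrable_indicator measurableSet_Ioi
  refine (h1.add h1.comp_neg).congr ?_
  have h0 : ∀ᵐ x : ℝ, x ≠ 0 := by simp [ae_iff]
  filter_upwards [h0] with x hx
  rcases lt_or_gt_of_ne hx with h | h
  · simp [indicator, h, abs_of_neg h, not_lt.2 h.le]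
  · simp [indicator, h, abs_of_pos h, not_lt.2 h.le]

lemma abs_rpow_mul_exp_integrable {r b s : ℝ} (hr : 0 < r) (hb : 0 < b) (hs : -1 < s) :
    Integrable (fun z : ℝ => |z| ^ s * Real.exp (-b * |z| ^ r)) :=
  integrable_comp_abs_of_integrableOn_Ioi (integrableOn_rpow_mul_exp_neg_mul_rpow hs hr hb)

lemma integral_abs_rpow_mul_exp {r b s : ℝ} (hr : 0 < r) (hb : 0 < b) (hs : -1 < s) :
    ∫ z : ℝ, |z| ^ s * Real.exp (-b * |z| ^ r) =
      2 * (b ^ (-(s + 1) / r) * (1 / r) * Real.Gamma ((s + 1) / r)) := by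
  rw [integral_comp_abs (f := fun z => z ^ s * Real.exp (-b * z ^ r)),
    integral_rpow_mul_exp_neg_mul_rpow hr hs hb]

lemma abs_rpow_mul_ggPdf_eq (r D s z : ℝ) :
    |z| ^ s * ggPdf r D z =
      (|z| ^ s * Real.exp (-(1 / (r * D)) * |z| ^ r)) * (ggConst r D)⁻¹ := by
  unfold ggPdf
  rw [div_eq_mul_inv, mul_assoc]
  congr 4
  ring

lemma integrable_abs_rpow_mul_ggPdf {r D s : ℝ} (hr : 0 < r) (hD : 0 < D) (hs : -1 < s) :
    Integrable (fun z => |z| ^ s * ggPdf r D z) := by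
  simp_rw [abs_rpow_mul_ggPdf_eq]
  exact (abs_rpow_mul_exp_integrable hr (by positivity) hs).mul_const _

lemma integral_abs_rpow_mul_ggPdf {r D s : ℝ} (hr : 0 < r) (hD : 0 < D) (hs : -1 < s) :
    ∫ z, |z| ^ s * ggPdf r D z =
      (r * D) ^ (s / r) * (1 / r) * Real.Gamma ((s + 1) / r) / Real.Gamma (1 + 1 / r) := by
  simp_rw [abs_rpow_mul_ggPdf_eq]
  rw [integral_mul_const, integral_abs_rpow_mul_exp hr (by positivity) hs]
  have hG := Real.Gamma_pos_of_pos (show 0 < 1 + 1 / r by positivity)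
  have hrD : 0 < r * D := by positivity
  have h1 : (1 / (r * D)) ^ (-(s + 1) / r) = (r * D) ^ (s / r) * (r * D) ^ (1 / r) := by
    rw [← Real.rpow_add hrD, one_div, Real.inv_rpow hrD.le, ← Real.rpow_neg hrD.le]
    congr 1; ring
  have h2 : 0 < (r * D) ^ (1 / r) := by positivity
  rw [h1, ggConst]
  field_simp

lemma Gamma_one_add_inv {r : ℝ} (hr : 0 < r) :
    Real.Gamma (1 + 1 / r) = 1 / r * Real.Gamma (1 / r) := by
  rw [add_comm, Real.Gamma_add_one (by positivity)]

lemma integrable_ggPdf {r D : ℝ} (hr : 0 < r) (hD : 0 < D) : Integrable (ggPdf r D) := by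
  simpa using integrable_abs_rpow_mul_ggPdf (s := 0) hr hD (by norm_num)

lemma integral_ggPdf {r D : ℝ} (hr : 0 < r) (hD : 0 < D) : ∫ z, ggPdf r D z = 1 := by
  have h := integral_abs_rpow_mul_ggPdf (s := 0) hr hD (by norm_num)
  have hG := Real.Gamma_pos_of_pos (show 0 < 1 + 1 / r by positivity)
  simp only [Real.rpow_zero, one_mul, zero_div, zero_add] at h
  rw [h, ← Gamma_one_add_inv hr, div_self hG.ne']

lemma integral_abs_rpow_self_mul_ggPdf {r D : ℝ} (hr : 0 < r) (hD : 0 < D) :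
    ∫ z, |z| ^ r * ggPdf r D z = D := by
  have hG := Real.Gamma_pos_of_pos (show 0 < 1 + 1 / r by positivity)
  rw [integral_abs_rpow_mul_ggPdf hr hD (by linarith), div_self hr.ne', Real.rpow_one,
    show (r + 1) / r = 1 + 1 / r by field_simp]
  field_simp

/-- The first absolute moment of the generalised Gaussian density vanishes as `D ↓ 0`. -/
lemma tendsto_integral_abs_mul_ggPdf {r : ℝ} (hr : 0 < r) :
    Tendsto (fun D => ∫ z, |z| * ggPdf r D z) (𝓝[>] (0 : ℝ)) (𝓝 0) := by
  have h1 : Tendsto (fun D : ℝ => (r * D) ^ (1 / r) * (1 / r) * Real.Gamma ((1 + 1) / r) /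
      Real.Gamma (1 + 1 / r)) (𝓝[>] (0 : ℝ)) (𝓝 0) := by
    have hc : Continuous (fun D : ℝ => (r * D) ^ (1 / r) * (1 / r) * Real.Gamma ((1 + 1) / r) /
        Real.Gamma (1 + 1 / r)) := by
      have : Continuous (fun D : ℝ => (r * D) ^ (1 / r)) :=
        (continuous_const.mul continuous_id).rpow_const (fun _ => Or.inr (by positivity))
      fun_prop
    have := hc.tendsto 0
    rw [mul_zero, Real.zero_rpow (by positivity)] at this
    simp only [zero_mul, zero_div] at this
    exact this.mono_left nhdsWithin_le_nhds
  refine h1.congr' ?_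
  filter_upwards [self_mem_nhdsWithin] with D hD
  have := integral_abs_rpow_mul_ggPdf (s := 1) hr (mem_Ioi.1 hD) (by norm_num)
  simpa using this.symm

/-- The space-filling gain of generalised Gaussian over uniform densities is positive. -/
lemma log_spaceFilling_pos {r : ℝ} (hr : 0 < r) :
    0 < (1 / r) * Real.log (Real.Gamma (1 + 1 / r) ^ r * Real.exp 1 / (1 + 1 / r)) := by
  have hG := Real.Gamma_pos_of_pos (show 0 < 1 + 1 / r by positivity)
  have ha : 0 < 1 + 1 / r := by positivity
  -- it suffices to compare `∫₀^∞ exp (-(1 + 1/r) x^r)` with the tangent line bound on `(0, 1]`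
  have hint : IntegrableOn (fun x : ℝ => Real.exp (-(1 + 1 / r) * x ^ r)) (Ioi 0) := by
    simpa using integrableOn_rpow_mul_exp_neg_mul_rpow (s := 0) (by norm_num) hr ha
  have hval := integral_exp_neg_mul_rpow hr ha
  have hsplit : ∫ x in Ioi (0 : ℝ), Real.exp (-(1 + 1 / r) * x ^ r) =
      (∫ x in Ioc (0 : ℝ) 1, Real.exp (-(1 + 1 / r) * x ^ r)) +
        ∫ x in Ioi (1 : ℝ), Real.exp (-(1 + 1 / r) * x ^ r) := by
    rw [← Ioc_union_Ioi_eq_Ioi (zero_le_one (α := ℝ))]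
    exact setIntegral_union (Set.disjoint_left.2 fun x hx hx' => not_lt.2 hx.2 hx')
      measurableSet_Ioi (hint.mono_set Ioc_subset_Ioi_self)
      (hint.mono_set (Ioi_subset_Ioi zero_le_one))
  have htail : 0 < ∫ x in Ioi (1 : ℝ), Real.exp (-(1 + 1 / r) * x ^ r) := by
    rw [setIntegral_pos_iff_support_of_nonneg_ae
      (Eventually.of_forall fun x => (Real.exp_pos _).le)
      (hint.mono_set (Ioi_subset_Ioi zero_le_one))]
    have : Function.support (fun x : ℝ => Real.exp (-(1 + 1 / r) * x ^ r)) = univ := by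
      ext x; simp [(Real.exp_pos _).ne']
    rw [this]; simp
  have hlow : Real.exp (-(1 / r)) ≤ ∫ x in Ioc (0 : ℝ) 1, Real.exp (-(1 + 1 / r) * x ^ r) := by
    have hpow : ∫ x in Ioc (0 : ℝ) 1, x ^ r = 1 / (r + 1) := by
      rw [← intervalIntegral.integral_of_le zero_le_one, integral_rpow (Or.inl (by linarith))]
      rw [Real.one_rpow, Real.zero_rpow (by linarith), sub_zero]
    have hpi : IntegrableOn (fun x : ℝ => x ^ r) (Ioc 0 1) := by
      have := (intervalIntegral.intervalIntegrable_rpow' (a := 0) (b := 1) (r := r) (by linarith))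
      rwa [intervalIntegrable_iff_integrableOn_Ioc_of_le zero_le_one] at this
    have hci : IntegrableOn (fun _ : ℝ => (1 : ℝ)) (Ioc 0 1) := by simp
    have e1 : ∫ x in Ioc (0 : ℝ) 1,
        Real.exp (-(1 / r)) * ((1 + 1 / r) * 1 - (1 + 1 / r) * x ^ r) = Real.exp (-(1 / r)) := by
      rw [integral_const_mul, integral_sub (hci.const_mul _) (hpi.const_mul _),
        integral_const_mul, integral_const_mul, hpow]
      simp
      field_simp
      ring
    rw [← e1]
    refine setIntegral_mono_on (((hci.const_mul _).sub (hpi.const_mul _)).const_mul _)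
      (hint.mono_set Ioc_subset_Ioi_self) measurableSet_Ioc fun x _ => ?_
    have h3 : Real.exp (-(1 + 1 / r) * x ^ r) =
        Real.exp (-(1 / r)) * Real.exp (1 / r - (1 + 1 / r) * x ^ r) := by
      rw [← Real.exp_add]; congr 1; ring
    rw [h3]
    refine mul_le_mul_of_nonneg_left ?_ (Real.exp_pos _).le
    have := Real.add_one_le_exp (1 / r - (1 + 1 / r) * x ^ r)
    linarith
  have hmain : Real.exp (-(1 / r)) < (1 + 1 / r) ^ (-1 / r) * Real.Gamma (1 / r + 1) := by
    rw [← hval, hsplit]; linarith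
  have hlog := Real.log_lt_log (Real.exp_pos _) hmain
  rw [add_comm (1 / r) 1, Real.log_exp, Real.log_mul (by positivity) hG.ne',
    Real.log_rpow ha] at hlog
  refine mul_pos (by positivity) ?_
  rw [Real.log_div (by positivity) ha.ne', Real.log_mul (by positivity) (by positivity),
    Real.log_rpow hG, Real.log_exp]
  have h4 := mul_lt_mul_of_pos_left hlog hr
  have h5 : r * -(1 / r) = -1 := by field_simp
  have h6 : r * (-1 / r * Real.log (1 + 1 / r) + Real.log (Real.Gamma (1 + 1 / r))) =
      -Real.log (1 + 1 / r) + r * Real.log (Real.Gamma (1 + 1 / r)) := by field_simp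
  rw [h5, h6] at h4
  linarith

/-- The density of `X + Y` for `X` of law `μ` and an independent standard Laplace variable `Y`. -/
def laplaceSmooth (μ : Measure ℝ) (x : ℝ) : ℝ := ∫ y, 1 / 2 * Real.exp (-|x - y|) ∂μ

section Laplace

variable (μ : Measure ℝ) [IsProbabilityMeasure μ]

lemma integrable_laplace_kernel (x : ℝ) :
    Integrable (fun y => 1 / 2 * Real.exp (-|x - y|)) μ := by
  refine Integrable.of_bound (C := 1 / 2) (by fun_prop) (Eventually.of_forall fun y => ?_)
  have : Real.exp (-|x - y|) ≤ 1 := Real.exp_le_one_iff.2 (by simp)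
  rw [Real.norm_eq_abs, abs_of_nonneg (by positivity)]
  linarith

lemma laplaceSmooth_pos (x : ℝ) : 0 < laplaceSmooth μ x := by
  unfold laplaceSmooth
  rw [integral_pos_iff_support_of_nonneg (fun y => by positivity) (integrable_laplace_kernel μ x)]
  have : Function.support (fun y : ℝ => 1 / 2 * Real.exp (-|x - y|)) = univ := by
    ext y; simp [(Real.exp_pos _).ne']
  rw [this]; simp

lemma laplaceSmooth_le (x : ℝ) : laplaceSmooth μ x ≤ 1 := by
  have h : laplaceSmooth μ x ≤ ∫ _, (1 : ℝ) ∂μ := by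
    refine integral_mono (integrable_laplace_kernel μ x) (integrable_const _) fun y => ?_
    have : Real.exp (-|x - y|) ≤ 1 := Real.exp_le_one_iff.2 (by simp)
    simp only
    linarith
  simpa using h

lemma laplaceSmooth_le_exp_mul (x x' : ℝ) :
    laplaceSmooth μ x ≤ Real.exp |x - x'| * laplaceSmooth μ x' := by
  unfold laplaceSmooth
  rw [← integral_const_mul]
  refine integral_mono (integrable_laplace_kernel μ x)
    ((integrable_laplace_kernel μ x').const_mul _) fun y => ?_
  simp only
  rw [mul_left_comm, ← Real.exp_add]
  have : |x' - y| ≤ |x - x'| + |x - y| := by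
    rw [abs_sub_comm x x']; exact abs_sub_le x' x y
  gcongr
  linarith

lemma abs_log_laplaceSmooth_sub_le (x x' : ℝ) :
    |Real.log (laplaceSmooth μ x) - Real.log (laplaceSmooth μ x')| ≤ |x - x'| := by
  have key : ∀ a b, Real.log (laplaceSmooth μ a) ≤ |a - b| + Real.log (laplaceSmooth μ b) := by
    intro a b
    have h := Real.log_le_log (laplaceSmooth_pos μ a) (laplaceSmooth_le_exp_mul μ a b)
    rwa [Real.log_mul (Real.exp_pos _).ne' (laplaceSmooth_pos μ b).ne', Real.log_exp] at h
  rw [abs_le]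
  have h1 := key x x'
  have h2 := key x' x
  rw [abs_sub_comm x' x] at h2
  constructor <;> linarith

lemma continuous_log_laplaceSmooth : Continuous fun x => Real.log (laplaceSmooth μ x) := by
  have : LipschitzWith 1 fun x => Real.log (laplaceSmooth μ x) :=
    LipschitzWith.of_dist_le_mul fun x y => by
      simpa [Real.dist_eq] using abs_log_laplaceSmooth_sub_le μ x y
  exact this.continuous

lemma continuous_laplaceSmooth : Continuous (laplaceSmooth μ) := by
  have := (continuous_log_laplaceSmooth μ).rexp
  refine this.congr fun x => Real.exp_log (laplaceSmooth_pos μ x)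

lemma integrable_laplace (y : ℝ) : Integrable (fun x : ℝ => 1 / 2 * Real.exp (-|x - y|)) := by
  have h : Integrable (fun x : ℝ => Real.exp (-|x|)) :=
    integrable_comp_abs_of_integrableOn_Ioi (integrableOn_exp_neg_Ioi 0)
  exact (h.comp_sub_right y).const_mul _

lemma integral_laplace (y : ℝ) : ∫ x : ℝ, 1 / 2 * Real.exp (-|x - y|) = 1 := by
  rw [integral_const_mul, integral_sub_right_eq_self (fun x => Real.exp (-|x|)) y,
    integral_comp_abs (f := fun x => Real.exp (-x)), integral_exp_neg_Ioi_zero]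
  norm_num

lemma integrable_laplace_prod :
    Integrable (fun p : ℝ × ℝ => 1 / 2 * Real.exp (-|p.1 - p.2|)) (volume.prod μ) := by
  rw [integrable_prod_iff' (by fun_prop)]
  refine ⟨Eventually.of_forall fun y => integrable_laplace y, ?_⟩
  have : (fun y : ℝ => ∫ x : ℝ, ‖1 / 2 * Real.exp (-|x - y|)‖) = fun _ => 1 := by
    funext y
    refine (integral_congr_ae (Eventually.of_forall fun x => ?_)).trans (integral_laplace y)
    exact abs_of_nonneg (by positivity)
  simp only [this]
  exact integrable_const _

lemma integrable_laplaceSmooth : Integrable (laplaceSmooth μ) :=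
  (integrable_laplace_prod μ).integral_prod_left

lemma integral_laplaceSmooth : ∫ x, laplaceSmooth μ x = 1 := by
  unfold laplaceSmooth
  rw [integral_integral_swap (integrable_laplace_prod μ)]
  simp only [integral_laplace, integral_const, probReal_univ, smul_eq_mul, mul_one]

lemma measure_floor_le_laplaceSmooth (x : ℝ) :
    1 / 2 * Real.exp (-1) * (μ {y | ⌊y⌋ = ⌊x⌋}).toReal ≤ laplaceSmooth μ x := by
  have hm : MeasurableSet {y : ℝ | ⌊y⌋ = ⌊x⌋} := Int.measurable_floor (measurableSet_singleton _)
  have h : ∫ y in {y : ℝ | ⌊y⌋ = ⌊x⌋}, 1 / 2 * Real.exp (-1) ∂μ ≤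
      ∫ y in {y : ℝ | ⌊y⌋ = ⌊x⌋}, 1 / 2 * Real.exp (-|x - y|) ∂μ := by
    refine setIntegral_mono_on integrableOn_const
      (integrable_laplace_kernel μ x).integrableOn hm fun y hy => ?_
    have := Int.abs_sub_lt_one_of_floor_eq_floor (show ⌊x⌋ = ⌊y⌋ from hy.symm)
    gcongr
  have h2 : ∫ y in {y : ℝ | ⌊y⌋ = ⌊x⌋}, 1 / 2 * Real.exp (-|x - y|) ∂μ ≤ laplaceSmooth μ x :=
    setIntegral_le_integral (integrable_laplace_kernel μ x)
      (Eventually.of_forall fun y => by positivity)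
  rw [setIntegral_const, smul_eq_mul, Measure.real, mul_comm] at h
  exact h.trans h2

lemma integrable_log_measure_floor
    (hfloor : Summable fun k : ℤ => Real.negMulLog (μ {x | ⌊x⌋ = k}).toReal) :
    Integrable (fun x => Real.log (μ {y | ⌊y⌋ = ⌊x⌋}).toReal) μ := by
  have hF : Measurable fun k : ℤ => Real.log (μ {y : ℝ | ⌊y⌋ = k}).toReal := measurable_from_top
  have hm : Measurable fun x : ℝ => Real.log (μ {y : ℝ | ⌊y⌋ = ⌊x⌋}).toReal :=
    hF.comp Int.measurable_floor
  refine ⟨hm.aestronglyMeasurable, ?_⟩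
  rw [hasFiniteIntegral_iff_norm]
  have h1 : ∫⁻ x, ENNReal.ofReal ‖Real.log (μ {y | ⌊y⌋ = ⌊x⌋}).toReal‖ ∂μ =
      ∫⁻ k, ENNReal.ofReal ‖Real.log (μ {y : ℝ | ⌊y⌋ = k}).toReal‖ ∂(μ.map Int.floor) :=
    (lintegral_map (f := fun k : ℤ => ENNReal.ofReal ‖Real.log (μ {y : ℝ | ⌊y⌋ = k}).toReal‖)
      measurable_from_top Int.measurable_floor).symm
  rw [h1, lintegral_countable']
  have h2 : ∀ k : ℤ, ENNReal.ofReal ‖Real.log (μ {y : ℝ | ⌊y⌋ = k}).toReal‖ *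
      (μ.map Int.floor) {k} = ENNReal.ofReal (Real.negMulLog (μ {x | ⌊x⌋ = k}).toReal) := by
    intro k
    rw [Measure.map_apply Int.measurable_floor (measurableSet_singleton _)]
    have h3 : (Int.floor ⁻¹' {k} : Set ℝ) = {x | ⌊x⌋ = k} := rfl
    rw [h3, ← ENNReal.ofReal_toReal (measure_ne_top μ {x : ℝ | ⌊x⌋ = k}),
      ← ENNReal.ofReal_mul (norm_nonneg _), ENNReal.toReal_ofReal ENNReal.toReal_nonneg]
    congr 1
    have h4 : (μ {x : ℝ | ⌊x⌋ = k}).toReal ≤ 1 := measureReal_le_one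
    have h5 : Real.log (μ {x : ℝ | ⌊x⌋ = k}).toReal ≤ 0 :=
      Real.log_nonpos ENNReal.toReal_nonneg h4
    rw [Real.norm_eq_abs, abs_of_nonpos h5, Real.negMulLog]
    ring
  simp_rw [h2]
  exact hfloor.tsum_ofReal_lt_top

lemma integrable_log_laplaceSmooth
    (hfloor : Summable fun k : ℤ => Real.negMulLog (μ {x | ⌊x⌋ = k}).toReal) :
    Integrable (fun x => Real.log (laplaceSmooth μ x)) μ := by
  have hF := integrable_log_measure_floor μ hfloor
  have hpos : ∀ᵐ x ∂μ, 0 < (μ {y : ℝ | ⌊y⌋ = ⌊x⌋}).toReal := by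
    have h : ∀ k : ℤ, ∀ᵐ x ∂μ, μ {y : ℝ | ⌊y⌋ = k} = 0 → ⌊x⌋ ≠ k := by
      intro k
      by_cases hk : μ {y : ℝ | ⌊y⌋ = k} = 0
      · have : ∀ᵐ x ∂μ, ⌊x⌋ ≠ k := by rw [ae_iff]; simpa using hk
        filter_upwards [this] with x hx _ using hx
      · exact Eventually.of_forall fun x hx => absurd hx hk
    filter_upwards [ae_all_iff.2 h] with x hx
    exact ENNReal.toReal_pos (fun h0 => hx ⌊x⌋ h0 rfl) (measure_ne_top _ _)
  refine ((integrable_const (Real.log (1 / 2 * Real.exp (-1)))).abs.add hF.abs).mono'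
    (continuous_log_laplaceSmooth μ).aestronglyMeasurable ?_
  filter_upwards [hpos] with x hx
  have h1 := Real.log_le_log (by positivity) (measure_floor_le_laplaceSmooth μ x)
  rw [Real.log_mul (by positivity) hx.ne'] at h1
  have h2 : Real.log (laplaceSmooth μ x) ≤ 0 :=
    Real.log_nonpos (laplaceSmooth_pos μ x).le (laplaceSmooth_le μ x)
  rw [Real.norm_eq_abs, abs_of_nonpos h2]
  have h3 := neg_abs_le (Real.log (1 / 2 * Real.exp (-1)))
  have h4 := neg_abs_le (Real.log (μ {y : ℝ | ⌊y⌋ = ⌊x⌋}).toReal)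
  simp only [Pi.add_apply]
  linarith

end Laplace

lemma abs_clamp_sub_le {n a b : ℝ} (ha : |a| ≤ n) : |a - max (-n) (min n b)| ≤ |a - b| := by
  rw [abs_le] at ha
  rcases max_cases (-n) (min n b) with h | h <;> rcases min_cases n b with h' | h' <;>
    rcases abs_cases (a - b) with h'' | h'' <;> rw [abs_le] <;> constructor <;> linarith

lemma abs_clamp_le {n : ℝ} (hn : 0 ≤ n) (b : ℝ) : |max (-n) (min n b)| ≤ n := by
  rw [abs_le]
  exact ⟨le_max_left _ _, max_le (by linarith) (min_le_left _ _)⟩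

lemma abs_exp_sub_exp_le {n a b : ℝ} (ha : a ≤ n) (hb : b ≤ n) :
    |Real.exp a - Real.exp b| ≤ Real.exp n * |a - b| := by
  have key : ∀ x y : ℝ, x ≤ n → Real.exp x - Real.exp y ≤ Real.exp n * |x - y| := by
    intro x y hx
    have h1 := Real.add_one_le_exp (y - x)
    have h2 : Real.exp y = Real.exp x * Real.exp (y - x) := by rw [← Real.exp_add]; congr 1; ring
    have h3 : Real.exp x ≤ Real.exp n := Real.exp_le_exp.2 hx
    have h4 := le_abs_self (x - y)
    calc Real.exp x - Real.exp y = Real.exp x * (1 - Real.exp (y - x)) := by rw [h2]; ring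
      _ ≤ Real.exp x * |x - y| := mul_le_mul_of_nonneg_left (by linarith) (Real.exp_pos _).le
      _ ≤ Real.exp n * |x - y| := mul_le_mul_of_nonneg_right h3 (abs_nonneg _)
  rw [abs_le]
  have h1 := key a b ha
  have h2 := key b a hb
  rw [abs_sub_comm b a] at h2
  constructor <;> linarith

lemma HasCompactSupport.clamp {g : ℝ → ℝ} (hg : HasCompactSupport g) {n : ℝ} (hn : 0 ≤ n) :
    HasCompactSupport fun x => max (-n) (min n (g x)) :=
  hg.comp_left (g := fun t => max (-n) (min n t)) (by simp [hn])

/-- A bounded measurable function can be replaced by a continuous, compactly supported one with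
the same bound, with small error in `L¹` of a finite measure. -/
lemma exists_hasCompactSupport_bounded_integral_sub_le {ρ : Measure ℝ} [IsFiniteMeasure ρ]
    {g : ℝ → ℝ} (hg : Measurable g) {n : ℝ} (hgn : ∀ x, |g x| ≤ n) {η : ℝ} (hη : 0 < η) :
    ∃ g' : ℝ → ℝ, Continuous g' ∧ HasCompactSupport g' ∧ (∀ x, |g' x| ≤ n) ∧
      ∫ x, |g x - g' x| ∂ρ ≤ η := by
  have hn : 0 ≤ n := (abs_nonneg _).trans (hgn 0)
  have hgi : Integrable g ρ :=
    Integrable.of_bound hg.aestronglyMeasurable n (Eventually.of_forall hgn)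
  obtain ⟨k, hk1, hk2, hk3, hk4⟩ := hgi.exists_hasCompactSupport_integral_sub_le hη
  refine ⟨fun x => max (-n) (min n (k x)), by fun_prop, hk1.clamp hn,
    fun x => abs_clamp_le hn _, le_trans ?_ hk2⟩
  refine integral_mono_of_nonneg (Eventually.of_forall fun x => abs_nonneg _) (hgi.sub hk4).norm
    (Eventually.of_forall fun x => ?_)
  exact abs_clamp_sub_le (hgn x)

lemma integral_density {α : Type*} [MeasurableSpace α] {ρ ρ' : Measure α} {f : α → ℝ}
    (hfm : Measurable f) (hf0 : ∀ x, 0 ≤ f x)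
    (hρ : ρ = ρ'.withDensity fun x => ENNReal.ofReal (f x)) (g : α → ℝ) :
    ∫ x, g x ∂ρ = ∫ x, f x * g x ∂ρ' := by
  rw [hρ, integral_withDensity_eq_integral_toReal_smul (by fun_prop) (by simp)]
  refine integral_congr_ae (Eventually.of_forall fun x => ?_)
  simp [ENNReal.toReal_ofReal (hf0 x)]

lemma integrable_density_iff {α : Type*} [MeasurableSpace α] {ρ ρ' : Measure α} {f : α → ℝ}
    (hfm : Measurable f) (hf0 : ∀ x, 0 ≤ f x)
    (hρ : ρ = ρ'.withDensity fun x => ENNReal.ofReal (f x)) {g : α → ℝ} :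
    Integrable g ρ ↔ Integrable (fun x => f x * g x) ρ' := by
  rw [hρ, integrable_withDensity_iff_integrable_smul' (by fun_prop) (by simp)]
  refine integrable_congr (Eventually.of_forall fun x => ?_)
  simp [ENNReal.toReal_ofReal (hf0 x)]

section Density

variable {μ : Measure ℝ} {f : ℝ → ℝ}

lemma ae_density_pos (hfm : Measurable f)
    (hμf : μ = volume.withDensity fun x => ENNReal.ofReal (f x)) : ∀ᵐ x ∂μ, 0 < f x := by
  rw [hμf, ae_withDensity_iff (by fun_prop)]
  refine Eventually.of_forall fun x hx => ?_
  simpa using hx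

/-- The logarithm of the ratio of `f` and the Laplace-smoothed law, truncated at level `n`. -/
def truncLogRatio (μ : Measure ℝ) (f : ℝ → ℝ) (n x : ℝ) : ℝ :=
  if f x = 0 then -n
  else max (-n) (min n (Real.log (f x) - Real.log (laplaceSmooth μ x)))

lemma abs_truncLogRatio_le {n : ℝ} (hn : 0 ≤ n) (x : ℝ) : |truncLogRatio μ f n x| ≤ n := by
  unfold truncLogRatio
  split_ifs
  · simp [abs_of_nonneg hn]
  · exact abs_clamp_le hn _

variable [IsProbabilityMeasure μ]

lemma measurable_truncLogRatio (hfm : Measurable f) (n : ℝ) :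
    Measurable (truncLogRatio μ f n) := by
  have := (continuous_log_laplaceSmooth μ).measurable
  exact Measurable.ite (hfm (measurableSet_singleton 0)) measurable_const
    (measurable_const.max (measurable_const.min (hfm.log.sub this)))

lemma laplaceSmooth_mul_exp_truncLogRatio_le (hf0 : ∀ x, 0 ≤ f x) (n x : ℝ) :
    laplaceSmooth μ x * Real.exp (truncLogRatio μ f n x) ≤
      f x + Real.exp (-n) * laplaceSmooth μ x := by
  have hw := laplaceSmooth_pos μ x
  unfold truncLogRatio
  split_ifs with h
  · rw [h]; linarith [mul_comm (laplaceSmooth μ x) (Real.exp (-n))]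
  · have hf : 0 < f x := lt_of_le_of_ne (hf0 x) (Ne.symm h)
    have h1 : max (-n) (min n (Real.log (f x) - Real.log (laplaceSmooth μ x))) ≤
        max (-n) (Real.log (f x) - Real.log (laplaceSmooth μ x)) :=
      max_le_max le_rfl (min_le_right _ _)
    have h2 : Real.exp (Real.log (f x) - Real.log (laplaceSmooth μ x)) =
        f x / laplaceSmooth μ x := by
      rw [Real.exp_sub, Real.exp_log hf, Real.exp_log hw]
    have h3 : Real.exp (max (-n) (min n (Real.log (f x) - Real.log (laplaceSmooth μ x)))) ≤
        Real.exp (-n) + f x / laplaceSmooth μ x := by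
      refine (Real.exp_le_exp.2 h1).trans ?_
      rcases max_cases (-n) (Real.log (f x) - Real.log (laplaceSmooth μ x)) with h4 | h4
      · rw [h4.1]; have := div_pos hf hw; linarith
      · rw [h4.1, h2]; linarith [Real.exp_pos (-n)]
    calc _ ≤ laplaceSmooth μ x * (Real.exp (-n) + f x / laplaceSmooth μ x) :=
          mul_le_mul_of_nonneg_left h3 hw.le
      _ = _ := by field_simp; ring

lemma tendsto_integral_truncLogRatio (hfm : Measurable f) (hf0 : ∀ x, 0 ≤ f x)
    (hμf : μ = volume.withDensity fun x => ENNReal.ofReal (f x))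
    (hent : Integrable (fun x => f x * Real.log (f x)))
    (hfloor : Summable fun k : ℤ => Real.negMulLog (μ {x | ⌊x⌋ = k}).toReal) :
    Tendsto (fun n : ℕ => ∫ x, truncLogRatio μ f n x ∂μ) atTop
      (𝓝 (∫ x, (Real.log (f x) - Real.log (laplaceSmooth μ x)) ∂μ)) := by
  have hi : Integrable (fun x => Real.log (f x) - Real.log (laplaceSmooth μ x)) μ :=
    ((integrable_density_iff hfm hf0 hμf).2 hent).sub (integrable_log_laplaceSmooth μ hfloor)
  refine tendsto_integral_of_dominated_convergence _
    (fun n => (measurable_truncLogRatio hfm _).aestronglyMeasurable) hi.norm ?_ ?_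
  · intro n
    filter_upwards [ae_density_pos hfm hμf] with x hx
    rw [truncLogRatio, if_neg hx.ne', Real.norm_eq_abs, Real.norm_eq_abs]
    have hn : |(0 : ℝ)| ≤ n := by simp
    have := abs_clamp_sub_le (b := Real.log (f x) - Real.log (laplaceSmooth μ x)) hn
    simpa only [zero_sub, abs_neg] using this
  · filter_upwards [ae_density_pos hfm hμf] with x hx
    obtain ⟨N, hN⟩ := exists_nat_ge |Real.log (f x) - Real.log (laplaceSmooth μ x)|
    refine tendsto_const_nhds.congr' ?_
    filter_upwards [eventually_ge_atTop N] with n hn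
    have h1 : |Real.log (f x) - Real.log (laplaceSmooth μ x)| ≤ n :=
      hN.trans (by exact_mod_cast hn)
    rw [abs_le] at h1
    rw [truncLogRatio, if_neg hx.ne', min_eq_right h1.2, max_eq_right h1.1]

/-- There is an almost normalised density `exp ℓ` whose logarithm varies slowly at small scales
and whose cross entropy with respect to `μ` is almost the differential entropy of `μ`. -/
lemma exists_slowly_varying_log_density (hfm : Measurable f) (hf0 : ∀ x, 0 ≤ f x)
    (hμf : μ = volume.withDensity fun x => ENNReal.ofReal (f x))
    (hent : Integrable (fun x => f x * Real.log (f x)))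
    (hfloor : Summable fun k : ℤ => Real.negMulLog (μ {x | ⌊x⌋ = k}).toReal)
    {ε : ℝ} (hε : 0 < ε) :
    ∃ (ℓ : ℝ → ℝ) (A : ℝ), Continuous ℓ ∧ (∀ x z, |ℓ (x + z) - ℓ x| ≤ ε + A * |z|) ∧
      Integrable ℓ μ ∧ Integrable (fun x => Real.exp (ℓ x)) ∧ ∫ x, Real.exp (ℓ x) ≤ 1 + ε ∧
      -∫ x, ℓ x ∂μ ≤ -(∫ x, f x * Real.log (f x)) + ε := by
  have hlf : Integrable (fun x => Real.log (f x)) μ := (integrable_density_iff hfm hf0 hμf).2 hent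
  have hlw := integrable_log_laplaceSmooth μ hfloor
  have hwi := integrable_laplaceSmooth μ
  have hw := laplaceSmooth_pos μ
  have hfi : Integrable f := by
    simpa using (integrable_density_iff hfm hf0 hμf).1 (integrable_const (1 : ℝ))
  have hf1 : ∫ x, f x = 1 := by
    have := integral_density hfm hf0 hμf (fun _ => 1)
    simpa using this.symm
  -- choice of the truncation level
  have hexp : Tendsto (fun n : ℕ => Real.exp (-(n : ℝ))) atTop (𝓝 0) :=
    Real.tendsto_exp_neg_atTop_nhds_zero.comp tendsto_natCast_atTop_atTop
  obtain ⟨n, hn1, hn2⟩ := (((tendsto_integral_truncLogRatio hfm hf0 hμf hent hfloor).eventually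
    (lt_mem_nhds (sub_lt_self _ (half_pos hε)))).and
      (hexp.eventually (gt_mem_nhds (half_pos hε)))).exists
  set u := truncLogRatio μ f n with hu
  have hun : ∀ x, |u x| ≤ n := abs_truncLogRatio_le (Nat.cast_nonneg n)
  have hum : Measurable u := measurable_truncLogRatio hfm n
  -- approximation by a continuous function
  set ν : Measure ℝ := volume.withDensity fun x => ENNReal.ofReal (laplaceSmooth μ x) with hν
  have hνfin : IsFiniteMeasure ν := isFiniteMeasure_withDensity_ofReal hwi.2
  obtain ⟨g, hgc, hgs, hgn, hgd⟩ := exists_hasCompactSupport_bounded_integral_sub_le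
    (ρ := μ + ν) hum hun (η := ε / 2 / Real.exp n) (by positivity)
  have hdm : Measurable fun x => |u x - g x| := (hum.sub hgc.measurable).abs
  have hdb : ∀ x, ‖|u x - g x|‖ ≤ n + n := fun x => by
    rw [norm_abs_eq_norm, Real.norm_eq_abs]
    exact (abs_sub _ _).trans (add_le_add (hun x) (hgn x))
  have hdμ : Integrable (fun x => |u x - g x|) μ :=
    Integrable.of_bound hdm.aestronglyMeasurable _ (Eventually.of_forall hdb)
  have hdν : Integrable (fun x => |u x - g x|) ν :=
    Integrable.of_bound hdm.aestronglyMeasurable _ (Eventually.of_forall hdb)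
  rw [integral_add_measure hdμ hdν] at hgd
  have hn0 : (1 : ℝ) ≤ Real.exp n := Real.one_le_exp (Nat.cast_nonneg n)
  have hgμ : ∫ x, |u x - g x| ∂μ ≤ ε / 2 := by
    have h1 : 0 ≤ ∫ x, |u x - g x| ∂ν := integral_nonneg fun x => abs_nonneg _
    have h2 : ε / 2 / Real.exp n ≤ ε / 2 := div_le_self (by positivity) hn0
    linarith
  have hgν : ∫ x, laplaceSmooth μ x * |u x - g x| ≤ ε / 2 / Real.exp n := by
    have h1 : 0 ≤ ∫ x, |u x - g x| ∂μ := integral_nonneg fun x => abs_nonneg _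
    rw [hν, integral_withDensity_eq_integral_toReal_smul
      (continuous_laplaceSmooth μ).measurable.ennreal_ofReal (by simp)] at hgd
    simp only [ENNReal.toReal_ofReal (hw _).le, smul_eq_mul] at hgd
    linarith
  have hdw : Integrable fun x => laplaceSmooth μ x * |u x - g x| :=
    hwi.mul_bdd hdm.aestronglyMeasurable (Eventually.of_forall hdb)
  have hgi : Integrable g μ :=
    Integrable.of_bound hgc.measurable.aestronglyMeasurable n (Eventually.of_forall hgn)
  have hui : Integrable u μ :=
    Integrable.of_bound hum.aestronglyMeasurable n (Eventually.of_forall hun)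
  have hexpl : ∀ x, Real.exp (Real.log (laplaceSmooth μ x) + g x) =
      laplaceSmooth μ x * Real.exp (g x) := fun x => by rw [Real.exp_add, Real.exp_log (hw x)]
  have huc := hgs.uniformContinuous_of_continuous hgc
  obtain ⟨δ, hδ, hδ'⟩ := Metric.uniformContinuous_iff.1 huc ε hε
  refine ⟨fun x => Real.log (laplaceSmooth μ x) + g x, 1 + 2 * n / δ,
    (continuous_log_laplaceSmooth μ).add hgc, ?_, hlw.add hgi, ?_, ?_, ?_⟩
  · intro x z
    have h1 := abs_log_laplaceSmooth_sub_le μ (x + z) x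
    rw [add_sub_cancel_left] at h1
    have h2 : |g (x + z) - g x| ≤ ε + 2 * n / δ * |z| := by
      rcases lt_or_ge |z| δ with hz | hz
      · have := hδ' (a := x + z) (b := x) (by simpa [Real.dist_eq] using hz)
        rw [Real.dist_eq] at this
        have h3 : 0 ≤ 2 * n / δ * |z| := by positivity
        linarith
      · have h3 : |g (x + z) - g x| ≤ n + n := (abs_sub _ _).trans (add_le_add (hgn _) (hgn _))
        have h4 : 2 * n / δ * δ ≤ 2 * n / δ * |z| := mul_le_mul_of_nonneg_left hz (by positivity)
        rw [div_mul_cancel₀ _ hδ.ne'] at h4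
        linarith
    calc _ = |(Real.log (laplaceSmooth μ (x + z)) - Real.log (laplaceSmooth μ x)) +
            (g (x + z) - g x)| := by congr 1; ring
      _ ≤ |z| + (ε + 2 * n / δ * |z|) := (abs_add_le _ _).trans (add_le_add h1 h2)
      _ = _ := by ring
  · simp only [hexpl]
    refine hwi.mul_bdd (c := Real.exp n) hgc.rexp.aestronglyMeasurable
      (Eventually.of_forall fun x => ?_)
    rw [Real.norm_eq_abs, abs_of_pos (Real.exp_pos _)]
    exact Real.exp_le_exp.2 ((le_abs_self _).trans (hgn x))
  · simp only [hexpl]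
    have hb : ∀ x, laplaceSmooth μ x * Real.exp (g x) ≤ f x + Real.exp (-n) * laplaceSmooth μ x +
        Real.exp n * (laplaceSmooth μ x * |u x - g x|) := by
      intro x
      have h1 := laplaceSmooth_mul_exp_truncLogRatio_le (μ := μ) hf0 n x
      have h2 := abs_exp_sub_exp_le ((le_abs_self _).trans (hgn x)) ((le_abs_self _).trans (hun x))
      have h3 := mul_le_mul_of_nonneg_left ((le_abs_self _).trans h2) (hw x).le
      rw [abs_sub_comm] at h3
      simp only [hu] at h3 ⊢
      nlinarith
    calc _ ≤ ∫ x, (f x + Real.exp (-n) * laplaceSmooth μ x +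
          Real.exp n * (laplaceSmooth μ x * |u x - g x|)) :=
          integral_mono_of_nonneg (Eventually.of_forall fun x =>
            mul_nonneg (hw x).le (Real.exp_pos _).le)
            ((hfi.add (hwi.const_mul _)).add (hdw.const_mul _)) (Eventually.of_forall hb)
      _ = 1 + Real.exp (-n) + Real.exp n * ∫ x, laplaceSmooth μ x * |u x - g x| := by
          have hfw : Integrable fun x => f x + Real.exp (-n) * laplaceSmooth μ x :=
            hfi.add (hwi.const_mul _)
          rw [integral_add hfw (hdw.const_mul _),
            integral_add hfi (hwi.const_mul _), integral_const_mul, integral_const_mul, hf1,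
            integral_laplaceSmooth, mul_one]
      _ ≤ 1 + ε := by
          have h5 := mul_le_mul_of_nonneg_left hgν (Real.exp_pos (n : ℝ)).le
          rw [mul_div_cancel₀ _ (Real.exp_pos (n : ℝ)).ne'] at h5
          linarith
  · rw [integral_add hlw hgi, ← integral_density hfm hf0 hμf]
    rw [integral_sub hlf hlw] at hn1
    have h6 : ∫ x, u x ∂μ - ∫ x, g x ∂μ ≤ ∫ x, |u x - g x| ∂μ := by
      rw [← integral_sub hui hgi]
      exact integral_mono (hui.sub hgi) hdμ fun x => le_abs_self _
    linarith

end Density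

section TestChannel

open ProbabilityTheory

/-- The additive-noise test channel `x ↦ x + Z` with generalised Gaussian noise `Z`. -/
def ggKernel (r D : ℝ) : Kernel ℝ ℝ :=
  (Kernel.const ℝ (volume : Measure ℝ)).withDensity
    fun x y => ENNReal.ofReal (ggPdf r D (y - x))

/-- The output density of the test channel. -/
def ggMix (r D : ℝ) (μ : Measure ℝ) (y : ℝ) : ℝ := ∫ x, ggPdf r D (y - x) ∂μ

variable {r D : ℝ} {μ : Measure ℝ} [IsProbabilityMeasure μ]

lemma measurable_ggPdf_sub : Measurable fun p : ℝ × ℝ => ggPdf r D (p.2 - p.1) :=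
  (measurable_ggPdf r D).comp (measurable_snd.sub measurable_fst)

lemma ggKernel_apply (x : ℝ) :
    ggKernel r D x = volume.withDensity fun y => ENNReal.ofReal (ggPdf r D (y - x)) := by
  rw [ggKernel, Kernel.withDensity_apply _ measurable_ggPdf_sub.ennreal_ofReal,
    Kernel.const_apply]

lemma isMarkovKernel_ggKernel (hr : 0 < r) (hD : 0 < D) : IsMarkovKernel (ggKernel r D) := by
  refine ⟨fun x => ⟨?_⟩⟩
  rw [ggKernel_apply, withDensity_apply _ MeasurableSet.univ, Measure.restrict_univ,
    ← ofReal_integral_eq_lintegral_ofReal ((integrable_ggPdf hr hD).comp_sub_right x)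
      (Eventually.of_forall fun y => (ggPdf_pos hr hD _).le),
    integral_sub_right_eq_self (ggPdf r D) x, integral_ggPdf hr hD, ENNReal.ofReal_one]

lemma compProd_ggKernel (hr : 0 < r) (hD : 0 < D) :
    μ.compProd (ggKernel r D) =
      (μ.prod volume).withDensity fun p => ENNReal.ofReal (ggPdf r D (p.2 - p.1)) := by
  have := isMarkovKernel_ggKernel hr hD
  ext s hs
  rw [Measure.compProd_apply hs, withDensity_apply _ hs, ← lintegral_indicator hs,
    lintegral_prod _ (measurable_ggPdf_sub.ennreal_ofReal.indicator hs).aemeasurable]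
  refine lintegral_congr fun x => ?_
  rw [ggKernel_apply, withDensity_apply _ (measurable_prodMk_left hs),
    ← lintegral_indicator (measurable_prodMk_left hs)]
  rfl

lemma integrable_ggPdf_sub (hr : 0 < r) (hD : 0 < D) (y : ℝ) :
    Integrable (fun x => ggPdf r D (y - x)) μ := by
  refine Integrable.of_bound (C := 1 / ggConst r D)
    ((measurable_ggPdf r D).comp (measurable_const.sub measurable_id)).aestronglyMeasurable
    (Eventually.of_forall fun x => ?_)
  rw [Real.norm_eq_abs, abs_of_pos (ggPdf_pos hr hD _)]
  exact ggPdf_le hr hD _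

lemma ggMix_pos (hr : 0 < r) (hD : 0 < D) (y : ℝ) : 0 < ggMix r D μ y := by
  rw [ggMix, integral_pos_iff_support_of_nonneg (fun x => (ggPdf_pos hr hD _).le)
    (integrable_ggPdf_sub hr hD y)]
  have : Function.support (fun x => ggPdf r D (y - x)) = univ := by
    ext x; simp [(ggPdf_pos hr hD _).ne']
  rw [this]; simp

lemma ggMix_le (hr : 0 < r) (hD : 0 < D) (y : ℝ) : ggMix r D μ y ≤ 1 / ggConst r D := by
  have := integral_mono (integrable_ggPdf_sub (μ := μ) hr hD y) (integrable_const _)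
    fun x => ggPdf_le hr hD (y - x)
  simpa [ggMix] using this

lemma measurable_ggMix : Measurable (ggMix r D μ) := by
  have h : StronglyMeasurable fun p : ℝ × ℝ => ggPdf r D (p.1 - p.2) :=
    ((measurable_ggPdf r D).comp (measurable_fst.sub measurable_snd)).stronglyMeasurable
  exact h.integral_prod_right.measurable

lemma map_fst_compProd_ggKernel (hr : 0 < r) (hD : 0 < D) :
    (μ.compProd (ggKernel r D)).map Prod.fst = μ := by
  have := isMarkovKernel_ggKernel hr hD
  exact Measure.fst_compProd μ _

lemma map_snd_compProd_ggKernel (hr : 0 < r) (hD : 0 < D) :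
    (μ.compProd (ggKernel r D)).map Prod.snd =
      volume.withDensity fun y => ENNReal.ofReal (ggMix r D μ y) := by
  ext s hs
  rw [compProd_ggKernel hr hD, Measure.map_apply measurable_snd hs,
    withDensity_apply _ (measurable_snd hs), withDensity_apply _ hs,
    ← lintegral_indicator (measurable_snd hs), ← lintegral_indicator hs,
    lintegral_prod_symm _
      (measurable_ggPdf_sub.ennreal_ofReal.indicator (measurable_snd hs)).aemeasurable]
  refine lintegral_congr fun y => ?_
  by_cases hy : y ∈ s
  · simp only [indicator, mem_preimage, hy, if_true]
    rw [ggMix, ofReal_integral_eq_lintegral_ofReal (integrable_ggPdf_sub hr hD y)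
      (Eventually.of_forall fun x => (ggPdf_pos hr hD _).le)]
  · simp [indicator, hy]

lemma integrable_comp_noise (hr : 0 < r) (hD : 0 < D) {G : ℝ → ℝ} (hG : Measurable G)
    (hGi : Integrable fun z => ggPdf r D z * G z) :
    Integrable (fun p : ℝ × ℝ => G (p.2 - p.1)) (μ.compProd (ggKernel r D)) := by
  rw [integrable_density_iff measurable_ggPdf_sub (fun p => (ggPdf_pos hr hD _).le)
    (compProd_ggKernel hr hD)]
  have hm : Measurable fun p : ℝ × ℝ => ggPdf r D (p.2 - p.1) * G (p.2 - p.1) :=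
    measurable_ggPdf_sub.mul (hG.comp (measurable_snd.sub measurable_fst))
  rw [integrable_prod_iff hm.aestronglyMeasurable]
  refine ⟨Eventually.of_forall fun x => hGi.comp_sub_right x, ?_⟩
  have h : ∀ x : ℝ, ∫ y, ‖ggPdf r D (y - x) * G (y - x)‖ = ∫ z, ‖ggPdf r D z * G z‖ := fun x =>
    integral_sub_right_eq_self (fun z => ‖ggPdf r D z * G z‖) x
  simp only [h]
  exact integrable_const _

lemma integral_comp_noise (hr : 0 < r) (hD : 0 < D) {G : ℝ → ℝ} (hG : Measurable G)
    (hGi : Integrable fun z => ggPdf r D z * G z) :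
    ∫ p : ℝ × ℝ, G (p.2 - p.1) ∂(μ.compProd (ggKernel r D)) = ∫ z, ggPdf r D z * G z := by
  have h := integrable_comp_noise (μ := μ) hr hD hG hGi
  rw [integrable_density_iff measurable_ggPdf_sub (fun p => (ggPdf_pos hr hD _).le)
    (compProd_ggKernel hr hD)] at h
  rw [integral_density measurable_ggPdf_sub (fun p => (ggPdf_pos hr hD _).le)
    (compProd_ggKernel hr hD), integral_prod _ h]
  have h : ∀ x : ℝ, ∫ y, ggPdf r D (y - x) * G (y - x) = ∫ z, ggPdf r D z * G z := fun x =>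
    integral_sub_right_eq_self (fun z => ggPdf r D z * G z) x
  simp [h]

lemma integrable_ggPdf_mul_abs_rpow (hr : 0 < r) (hD : 0 < D) :
    Integrable fun z => ggPdf r D z * |z| ^ r := by
  simpa only [mul_comm] using integrable_abs_rpow_mul_ggPdf (s := r) hr hD (by linarith)

lemma integrable_ggPdf_mul_abs (hr : 0 < r) (hD : 0 < D) :
    Integrable fun z => ggPdf r D z * |z| := by
  simpa only [mul_comm, Real.rpow_one] using
    integrable_abs_rpow_mul_ggPdf (s := 1) hr hD (by norm_num)

lemma distortion_ggKernel (hr : 0 < r) (hD : 0 < D) :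
    ∫⁻ p : ℝ × ℝ, ENNReal.ofReal (|p.1 - p.2| ^ r) ∂(μ.compProd (ggKernel r D)) =
      ENNReal.ofReal D := by
  have hG : Measurable fun z : ℝ => |z| ^ r := by fun_prop
  have hi := integrable_comp_noise (μ := μ) hr hD hG (integrable_ggPdf_mul_abs_rpow hr hD)
  have hv := integral_comp_noise (μ := μ) hr hD hG (integrable_ggPdf_mul_abs_rpow hr hD)
  simp_rw [abs_sub_comm (Prod.fst _)]
  rw [← ofReal_integral_eq_lintegral_ofReal hi (Eventually.of_forall fun p => by positivity), hv]
  simp_rw [mul_comm (ggPdf r D _)]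
  rw [integral_abs_rpow_self_mul_ggPdf hr hD]

lemma compProd_ggKernel_eq_withDensity_prod (hr : 0 < r) (hD : 0 < D) :
    μ.compProd (ggKernel r D) =
      (μ.prod (volume.withDensity fun y => ENNReal.ofReal (ggMix r D μ y))).withDensity
        fun p => ENNReal.ofReal (ggPdf r D (p.2 - p.1) / ggMix r D μ p.2) := by
  have hm2 : Measurable fun p : ℝ × ℝ => ENNReal.ofReal (ggMix r D μ p.2) :=
    (measurable_ggMix.comp measurable_snd).ennreal_ofReal
  have hq : Measurable fun p : ℝ × ℝ =>
      ENNReal.ofReal (ggPdf r D (p.2 - p.1) / ggMix r D μ p.2) :=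
    (measurable_ggPdf_sub.div (measurable_ggMix.comp measurable_snd)).ennreal_ofReal
  rw [prod_withDensity_right measurable_ggMix.ennreal_ofReal, ← withDensity_mul _ hm2 hq,
    compProd_ggKernel hr hD]
  congr 1
  funext p
  have hm := ggMix_pos (μ := μ) hr hD p.2
  simp only [Pi.mul_apply]
  rw [← ENNReal.ofReal_mul hm.le, mul_div_cancel₀ _ hm.ne']

/-- The rate of the generalised Gaussian test channel, bounded through an almost normalised
reference density `exp ℓ` whose logarithm varies slowly. -/
lemma RDfun_le_of_log_density (hr : 0 < r) (hD : 0 < D) {ℓ : ℝ → ℝ} {ω A ε : ℝ}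
    (hℓc : Continuous ℓ) (hosc : ∀ x z, |ℓ (x + z) - ℓ x| ≤ ω + A * |z|) (hℓμ : Integrable ℓ μ)
    (hexp : Integrable fun x => Real.exp (ℓ x)) (hexp1 : ∫ x, Real.exp (ℓ x) ≤ 1 + ε) :
    RDfun μ (fun x => |x|) r D ≤ ENNReal.ofReal
      (-Real.log (ggConst r D) - 1 / r - ∫ x, ℓ x ∂μ + ω + A * (∫ z, |z| * ggPdf r D z) + ε) := by
  have hMk := isMarkovKernel_ggKernel hr hD
  set π := μ.compProd (ggKernel r D) with hπ
  have hfst : π.map Prod.fst = μ := map_fst_compProd_ggKernel hr hD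
  have hsnd := map_snd_compProd_ggKernel (μ := μ) hr hD
  have hK := ggConst_pos hr hD
  have hm := ggMix_pos (μ := μ) hr hD
  refine (iInf₂_le (ggKernel r D) hMk).trans ((iInf_le _ (distortion_ggKernel hr hD).le).trans ?_)
  rw [← hπ, mutualInfo, hfst, hsnd]
  set ν := μ.prod (volume.withDensity fun y => ENNReal.ofReal (ggMix r D μ y)) with hν
  have hπν : π = ν.withDensity
      fun p => ENNReal.ofReal (ggPdf r D (p.2 - p.1) / ggMix r D μ p.2) :=
    compProd_ggKernel_eq_withDensity_prod hr hD
  have hac : π ≪ ν := by rw [hπν]; exact withDensity_absolutelyContinuous _ _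
  have hsf : SigmaFinite ν := by rw [hν]; infer_instance
  have hrn : (fun p => Real.log (π.rnDeriv ν p).toReal) =ᵐ[π] fun p =>
      Real.log (ggPdf r D (p.2 - p.1)) - Real.log (ggMix r D μ p.2) := by
    have h1 : π.rnDeriv ν =ᵐ[ν] fun p =>
        ENNReal.ofReal (ggPdf r D (p.2 - p.1) / ggMix r D μ p.2) := by
      rw [hπν]
      exact Measure.rnDeriv_withDensity ν
        (measurable_ggPdf_sub.div (measurable_ggMix.comp measurable_snd)).ennreal_ofReal
    filter_upwards [hac.ae_le h1] with p hp
    rw [hp, ENNReal.toReal_ofReal (div_pos (ggPdf_pos hr hD _) (hm _)).le,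
      Real.log_div (ggPdf_pos hr hD _).ne' (hm _).ne']
  -- the noise term
  have hnm : Measurable fun z => Real.log (ggPdf r D z) := (measurable_ggPdf r D).log
  have hni : Integrable fun z => ggPdf r D z * Real.log (ggPdf r D z) := by
    simp_rw [log_ggPdf hr hD, mul_sub]
    refine Integrable.sub ?_ ((integrable_ggPdf hr hD).mul_const _)
    refine ((integrable_ggPdf_mul_abs_rpow hr hD).mul_const (-(1 / (r * D)))).congr
      (Eventually.of_forall fun z => ?_)
    simp only; ring
  have hnv : ∫ z, ggPdf r D z * Real.log (ggPdf r D z) = -Real.log (ggConst r D) - 1 / r := by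
    have h1 : ∀ z, ggPdf r D z * Real.log (ggPdf r D z) =
        (-(1 / (r * D))) * (|z| ^ r * ggPdf r D z) - Real.log (ggConst r D) * ggPdf r D z := by
      intro z; rw [log_ggPdf hr hD]; ring
    simp_rw [h1]
    rw [integral_sub ((integrable_abs_rpow_mul_ggPdf hr hD (by linarith)).const_mul _)
      ((integrable_ggPdf hr hD).const_mul _), integral_const_mul, integral_const_mul,
      integral_ggPdf hr hD, integral_abs_rpow_self_mul_ggPdf hr hD]
    field_simp
    ring
  have hNi := integrable_comp_noise (μ := μ) hr hD hnm hni
  have hNv := integral_comp_noise (μ := μ) hr hD hnm hni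
  rw [hnv] at hNv
  -- the reference density at the output
  have hAi := integrable_comp_noise (μ := μ) hr hD measurable_id.abs
    (integrable_ggPdf_mul_abs hr hD)
  have hAv := integral_comp_noise (μ := μ) hr hD measurable_id.abs
    (integrable_ggPdf_mul_abs hr hD)
  simp only [id] at hAi hAv
  rw [← hπ] at hAi hAv hNi hNv
  have hℓ1 : Integrable (fun p : ℝ × ℝ => ℓ p.1) π := by
    have h : Integrable ℓ (π.map Prod.fst) := by rwa [hfst]
    exact h.comp_measurable measurable_fst
  have hℓ1v : ∫ p, ℓ p.1 ∂π = ∫ x, ℓ x ∂μ := by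
    conv_rhs => rw [← hfst]
    exact (integral_map measurable_fst.aemeasurable hℓc.aestronglyMeasurable).symm
  have hbound : ∀ p : ℝ × ℝ, |ℓ p.2 - ℓ p.1| ≤ ω + A * |p.2 - p.1| := fun p => by
    simpa using hosc p.1 (p.2 - p.1)
  have hπprob : IsProbabilityMeasure π := by rw [hπ]; infer_instance
  have hBi : Integrable (fun p : ℝ × ℝ => ω + A * |p.2 - p.1|) π :=
    (integrable_const ω).add (hAi.const_mul A)
  have hℓ2 : Integrable (fun p : ℝ × ℝ => ℓ p.2) π := by
    have hd : Integrable (fun p : ℝ × ℝ => ℓ p.2 - ℓ p.1) π :=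
      hBi.mono' ((hℓc.comp continuous_snd).sub (hℓc.comp continuous_fst)).aestronglyMeasurable
        (Eventually.of_forall hbound)
    refine (hd.add hℓ1).congr (Eventually.of_forall fun p => ?_)
    simp
  have hℓ2v : ∫ x, ℓ x ∂μ - ω - A * (∫ z, |z| * ggPdf r D z) ≤ ∫ p, ℓ p.2 ∂π := by
    have h1 : ∫ p, (ℓ p.1 - (ω + A * |p.2 - p.1|)) ∂π ≤ ∫ p, ℓ p.2 ∂π := by
      refine integral_mono (hℓ1.sub hBi) hℓ2 fun p => ?_
      have := (abs_le.1 (hbound p)).1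
      simp only
      linarith
    rw [integral_sub hℓ1 hBi, integral_add (integrable_const ω) (hAi.const_mul A),
      integral_const_mul, hAv, hℓ1v] at h1
    simp only [integral_const, probReal_univ, smul_eq_mul, one_mul, mul_comm (ggPdf r D _)] at h1
    linarith
  have hqm : Measurable fun y => Real.exp (ℓ y) / ggMix r D μ y :=
    hℓc.rexp.measurable.div measurable_ggMix
  have hcancel : ∀ y, ggMix r D μ y * (Real.exp (ℓ y) / ggMix r D μ y) = Real.exp (ℓ y) :=
    fun y => mul_div_cancel₀ _ (hm y).ne'
  have hq : Integrable (fun y => Real.exp (ℓ y) / ggMix r D μ y) (π.map Prod.snd) := by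
    rw [integrable_density_iff measurable_ggMix (fun y => (hm y).le) hsnd]
    simpa only [hcancel] using hexp
  have hq2 : Integrable (fun p : ℝ × ℝ => Real.exp (ℓ p.2) / ggMix r D μ p.2) π :=
    hq.comp_measurable measurable_snd
  have hq2v : ∫ p, Real.exp (ℓ p.2) / ggMix r D μ p.2 ∂π ≤ 1 + ε := by
    have h1 := integral_map (μ := π) measurable_snd.aemeasurable hqm.aestronglyMeasurable
    rw [← h1, integral_density measurable_ggMix (fun y => (hm y).le) hsnd]
    simpa only [hcancel] using hexp1
  -- the output density
  have hlow : ∀ y, ℓ y + 1 - Real.exp (ℓ y) / ggMix r D μ y ≤ Real.log (ggMix r D μ y) := by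
    intro y
    have h1 := Real.log_le_sub_one_of_pos (div_pos (Real.exp_pos (ℓ y)) (hm y))
    rw [Real.log_div (Real.exp_pos _).ne' (hm y).ne', Real.log_exp] at h1
    linarith
  have hLi : Integrable (fun p : ℝ × ℝ => ℓ p.2 + 1 - Real.exp (ℓ p.2) / ggMix r D μ p.2) π :=
    (hℓ2.add (integrable_const 1)).sub hq2
  have hmi : Integrable (fun p : ℝ × ℝ => Real.log (ggMix r D μ p.2)) π := by
    refine ((integrable_const (Real.log (1 / ggConst r D))).abs.add hLi.abs).mono'
      (measurable_ggMix.comp measurable_snd).log.aestronglyMeasurable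
      (Eventually.of_forall fun p => ?_)
    have h1 := Real.log_le_log (hm p.2) (ggMix_le hr hD p.2)
    have h2 := le_abs_self (Real.log (1 / ggConst r D))
    have h3 := neg_abs_le (ℓ p.2 + 1 - Real.exp (ℓ p.2) / ggMix r D μ p.2)
    have h4 := hlow p.2
    have h5 := abs_nonneg (Real.log (1 / ggConst r D))
    have h6 := abs_nonneg (ℓ p.2 + 1 - Real.exp (ℓ p.2) / ggMix r D μ p.2)
    simp only [Pi.add_apply, Real.norm_eq_abs]
    rw [abs_le]
    constructor <;> linarith
  have hmv : ∫ x, ℓ x ∂μ - ω - A * (∫ z, |z| * ggPdf r D z) - ε ≤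
      ∫ p, Real.log (ggMix r D μ p.2) ∂π := by
    have h1 := integral_mono hLi hmi fun p => hlow p.2
    have hℓ3 : Integrable (fun p : ℝ × ℝ => ℓ p.2 + 1) π := hℓ2.add (integrable_const 1)
    rw [integral_sub hℓ3 hq2,
      integral_add hℓ2 (integrable_const 1)] at h1
    simp only [integral_const, probReal_univ, smul_eq_mul, one_mul] at h1
    linarith
  have hint : Integrable (fun p => Real.log (π.rnDeriv ν p).toReal) π :=
    (hNi.sub hmi).congr hrn.symm
  rw [klDiv, if_pos ⟨hac, hint⟩]
  refine ENNReal.ofReal_le_ofReal ?_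
  rw [integral_congr_ae hrn, integral_sub hNi hmi, hNv]
  linarith

end TestChannel

lemma tendsto_neg_log_ggConst {r : ℝ} (hr : 0 < r) :
    Tendsto (fun D => -Real.log (ggConst r D)) (𝓝[>] (0 : ℝ)) atTop := by
  have hG := Real.Gamma_pos_of_pos (show 0 < 1 + 1 / r by positivity)
  have h1 : Tendsto (fun D : ℝ => (1 / r) * Real.log D) (𝓝[>] (0 : ℝ)) atBot :=
    Real.tendsto_log_nhdsGT_zero.const_mul_atBot (by positivity)
  have h2 := tendsto_neg_atBot_atTop.comp (tendsto_atBot_add_const_left _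
    (Real.log 2 + 1 / r * Real.log r + Real.log (Real.Gamma (1 + 1 / r))) h1)
  refine h2.congr' ?_
  filter_upwards [self_mem_nhdsWithin] with D hD
  have hD : 0 < D := hD
  simp only [Function.comp_apply]
  rw [ggConst, Real.log_mul (by positivity) hG.ne', Real.log_mul (by norm_num) (by positivity),
    Real.log_rpow (by positivity), Real.log_mul hr.ne' hD.ne']
  ring

/-- The Shannon lower bound is asymptotically tight (upper bound on `R(D)`). -/
lemma eventually_RDfun_toReal_le {r : ℝ} (hr : 0 < r) {μ : Measure ℝ} [IsProbabilityMeasure μ]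
    {f : ℝ → ℝ} (hfm : Measurable f) (hf0 : ∀ x, 0 ≤ f x)
    (hμf : μ = volume.withDensity fun x => ENNReal.ofReal (f x))
    (hent : Integrable (fun x => f x * Real.log (f x)))
    (hfloor : Summable fun k : ℤ => Real.negMulLog (μ {x | ⌊x⌋ = k}).toReal)
    {ε : ℝ} (hε : 0 < ε) :
    ∀ᶠ D in 𝓝[>] (0 : ℝ), (RDfun μ (fun x => |x|) r D).toReal ≤
      -Real.log (ggConst r D) - 1 / r - (∫ x, f x * Real.log (f x)) + ε := by
  obtain ⟨ℓ, A, hℓc, hosc, hℓμ, hexp, hexp1, hℓ⟩ :=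
    exists_slowly_varying_log_density hfm hf0 hμf hent hfloor (show 0 < ε / 4 by linarith)
  have hA : Tendsto (fun D => A * ∫ z, |z| * ggPdf r D z) (𝓝[>] (0 : ℝ)) (𝓝 0) := by
    simpa using (tendsto_integral_abs_mul_ggPdf hr).const_mul A
  filter_upwards [self_mem_nhdsWithin, hA.eventually (gt_mem_nhds (show 0 < ε / 4 by linarith)),
    (tendsto_neg_log_ggConst hr).eventually_ge_atTop
      (1 / r + ∫ x, f x * Real.log (f x))] with D hD hAD hlog
  refine ENNReal.toReal_le_of_le_ofReal (by linarith)
    ((RDfun_le_of_log_density hr hD hℓc hosc hℓμ hexp hexp1).trans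
      (ENNReal.ofReal_le_ofReal ?_))
  linarith

/-- Log-sum inequality (Gibbs' inequality on a set). -/
lemma mul_log_add_le_setIntegral_mul_log {f v : ℝ → ℝ} {S : Set ℝ} (hf0 : ∀ x, 0 ≤ f x)
    (hf : IntegrableOn f S) (hfl : IntegrableOn (fun x => f x * Real.log (f x)) S)
    (hv0 : ∀ x, 0 < v x) (hv : IntegrableOn v S)
    (hfv : IntegrableOn (fun x => f x * Real.log (v x)) S) {V : ℝ} (hV0 : 0 < V)
    (hV : ∫ x in S, v x ≤ V) :
    (∫ x in S, f x * Real.log (v x)) - (∫ x in S, f x) * Real.log V ≤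
      (∫ x in S, f x * Real.log (f x)) + Real.negMulLog (∫ x in S, f x) := by
  set p := ∫ x in S, f x with hp
  have hp0 : 0 ≤ p := integral_nonneg hf0
  rcases hp0.eq_or_lt with h | h
  · have h0 : f =ᵐ[volume.restrict S] 0 :=
      (integral_eq_zero_iff_of_nonneg hf0 hf).1 (hp.symm.trans h.symm)
    have e1 : ∫ x in S, f x * Real.log (v x) = 0 := integral_eq_zero_of_ae (by
      filter_upwards [h0] with x hx
      simp [hx])
    have e2 : ∫ x in S, f x * Real.log (f x) = 0 := integral_eq_zero_of_ae (by
      filter_upwards [h0] with x hx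
      simp [hx])
    rw [e1, e2, ← h]; simp
  · set t := p / V with ht
    have ht0 : 0 < t := by positivity
    have key : ∀ x, f x * Real.log (v x) + (Real.log t + 1) * f x - t * v x ≤
        f x * Real.log (f x) := by
      intro x
      rcases (hf0 x).eq_or_lt with hx | hx
      · rw [← hx]
        have := mul_pos ht0 (hv0 x)
        simp; linarith
      · have h1 := Real.log_le_sub_one_of_pos (show 0 < t * v x / f x by
          have := hv0 x; positivity)
        rw [Real.log_div (mul_pos ht0 (hv0 x)).ne' hx.ne',
          Real.log_mul ht0.ne' (hv0 x).ne'] at h1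
        have h2 := mul_le_mul_of_nonneg_left h1 hx.le
        have h3 : f x * (t * v x / f x - 1) = t * v x - f x := by field_simp
        rw [h3] at h2
        nlinarith
    have h1 := integral_mono (μ := volume.restrict S)
      ((hfv.add (hf.const_mul (Real.log t + 1))).sub (hv.const_mul t)) hfl key
    rw [integral_sub' (hfv.add (hf.const_mul _)) (hv.const_mul _),
      integral_add' hfv (hf.const_mul _), integral_const_mul, integral_const_mul, ← hp, ht,
      Real.log_div h.ne' hV0.ne'] at h1
    have h2 : p / V * ∫ x in S, v x ≤ p := by
      calc p / V * ∫ x in S, v x ≤ p / V * V := by gcongr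
        _ = p := by field_simp
    unfold Real.negMulLog
    linarith

lemma integrable_max_rpow_sub_abs_rpow {r ρ : ℝ} (hr : 0 < r) (hρ : 0 ≤ ρ) :
    IntegrableOn (fun x : ℝ => max (ρ ^ r - x ^ r) 0) (Ioi 0) ∧
    ∫ x in Ioi (0 : ℝ), max (ρ ^ r - x ^ r) 0 = ρ * ρ ^ r * (r / (r + 1)) := by
  have e : ∀ x ∈ Ioi (0 : ℝ), max (ρ ^ r - x ^ r) 0 =
      (Ioc 0 ρ).indicator (fun x => ρ ^ r - x ^ r) x := by
    intro x hx
    by_cases h : x ≤ ρ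
    · rw [indicator_of_mem (show x ∈ Ioc 0 ρ from ⟨hx, h⟩), max_eq_left]
      exact sub_nonneg.2 (Real.rpow_le_rpow (le_of_lt hx) h hr.le)
    · rw [indicator_of_notMem (fun h' => h h'.2), max_eq_right]
      exact sub_nonpos.2 (Real.rpow_le_rpow hρ (not_le.1 h).le hr.le)
  have hi : IntervalIntegrable (fun x : ℝ => ρ ^ r - x ^ r) volume 0 ρ :=
    intervalIntegrable_const.sub (intervalIntegral.intervalIntegrable_rpow' (by linarith))
  have hi' : IntegrableOn (fun x : ℝ => ρ ^ r - x ^ r) (Ioc 0 ρ) := by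
    rwa [intervalIntegrable_iff_integrableOn_Ioc_of_le hρ] at hi
  have hind := hi'.integrable_indicator measurableSet_Ioc
  refine ⟨hind.integrableOn.congr_fun (fun x hx => (e x hx).symm) measurableSet_Ioi, ?_⟩
  rw [setIntegral_congr_fun measurableSet_Ioi e, setIntegral_indicator measurableSet_Ioc,
    inter_eq_right.2 (show Ioc 0 ρ ⊆ Ioi 0 from fun x hx => hx.1), ← intervalIntegral.integral_of_le hρ,
    intervalIntegral.integral_sub intervalIntegrable_const
      (intervalIntegral.intervalIntegrable_rpow' (by linarith)),
    integral_rpow (Or.inl (by linarith)), intervalIntegral.integral_const,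
    Real.zero_rpow (by linarith)]
  rcases hρ.eq_or_lt with h | h
  · rw [← h, Real.zero_rpow (by linarith)]; simp [Real.zero_rpow (show r + 1 ≠ 0 by linarith)]
  · rw [Real.rpow_add h, Real.rpow_one]
    simp only [smul_eq_mul]
    field_simp
    ring

/-- The moment of a nearly uniform density about any point is nearly at least that of the uniform
density about its centre. -/
lemma rpow_mul_setIntegral_sub_le {f : ℝ → ℝ} {S : Set ℝ} {r ρ u c : ℝ} (hr : 0 < r)
    (hρ : 0 ≤ ρ) (hu : 0 ≤ u) (hS : volume S ≠ ⊤) (hf0 : ∀ x, 0 ≤ f x) (hf : IntegrableOn f S)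
    (hfc : IntegrableOn (fun x => f x * |x - c| ^ r) S) :
    ρ ^ r * (∫ x in S, f x) - u * (2 * (ρ * ρ ^ r * (r / (r + 1)))) -
      ρ ^ r * (∫ x in S, |f x - u|) ≤ ∫ x in S, f x * |x - c| ^ r := by
  obtain ⟨hi, he⟩ := integrable_max_rpow_sub_abs_rpow hr hρ
  set k : ℝ → ℝ := fun x => max (ρ ^ r - x ^ r) 0
  have hk0 : ∀ x, 0 ≤ k x := fun x => le_max_right _ _
  have hki : Integrable (fun x => k |x|) := integrable_comp_abs_of_integrableOn_Ioi hi
  have hkc : Integrable (fun x => k |x - c|) := hki.comp_sub_right c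
  have hkv : ∫ x, k |x - c| = 2 * (ρ * ρ ^ r * (r / (r + 1))) := by
    rw [integral_sub_right_eq_self (fun x => k |x|) c, integral_comp_abs (f := k), he]
  have hfu : IntegrableOn (fun x => |f x - u|) S :=
    (hf.sub (integrableOn_const hS)).norm
  have key : ∀ x, ρ ^ r * f x - u * k |x - c| - ρ ^ r * |f x - u| ≤ f x * |x - c| ^ r := by
    intro x
    have hρr : 0 ≤ ρ ^ r := by positivity
    have hx : 0 ≤ |x - c| ^ r := by positivity
    have hab := abs_nonneg (f x - u)
    have hle := le_abs_self (f x - u)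
    have hfx := hf0 x
    rcases le_total (ρ ^ r) (|x - c| ^ r) with h | h
    · have e : k |x - c| = 0 := max_eq_right (by linarith)
      rw [e]
      nlinarith
    · have e : k |x - c| = ρ ^ r - |x - c| ^ r := max_eq_left (by linarith)
      rw [e]
      nlinarith [mul_nonneg hx hab, mul_le_mul_of_nonneg_left hle (sub_nonneg.2 h)]
  have h1 := integral_mono (μ := volume.restrict S)
    (((hf.const_mul (ρ ^ r)).sub (hkc.integrableOn.const_mul u)).sub (hfu.const_mul (ρ ^ r)))
    hfc key
  rw [integral_sub' ((hf.const_mul (ρ ^ r)).sub (hkc.integrableOn.const_mul u))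
    (hfu.const_mul (ρ ^ r)), integral_sub' (hf.const_mul (ρ ^ r)) (hkc.integrableOn.const_mul u),
    integral_const_mul, integral_const_mul, integral_const_mul] at h1
  have h2 : ∫ x in S, k |x - c| ≤ 2 * (ρ * ρ ^ r * (r / (r + 1))) := by
    rw [← hkv]
    exact setIntegral_le_integral hkc (Eventually.of_forall fun x => hk0 _)
  nlinarith [mul_le_mul_of_nonneg_left h2 hu]

lemma min_sq_le_sub_one_sub_log {y t : ℝ} (hy : 0 < y) (ht : 0 < t) (h : t < |y - 1|) :
    min 1 (t / 3) ^ 2 ≤ y - 1 - Real.log y := by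
  set s := √y with hs
  have hs0 : 0 < s := Real.sqrt_pos.2 hy
  have hsy : y = s ^ 2 := (Real.sq_sqrt hy.le).symm
  have hlog : Real.log y ≤ 2 * (s - 1) := by
    rw [hsy, Real.log_pow]
    have := Real.log_le_sub_one_of_pos hs0
    push_cast; linarith
  have h1 : min 1 (t / 3) ≤ |s - 1| := by
    rcases le_total 1 |s - 1| with h' | h'
    · exact (min_le_left _ _).trans h'
    · refine (min_le_right _ _).trans ?_
      have h2 : |y - 1| = |s - 1| * (s + 1) := by
        rw [hsy, show s ^ 2 - 1 = (s - 1) * (s + 1) by ring, abs_mul,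
          abs_of_pos (show 0 < s + 1 by linarith)]
      have h3 : s + 1 ≤ 3 := by linarith [(abs_le.1 h').2]
      have h4 := mul_le_mul_of_nonneg_left h3 (abs_nonneg (s - 1))
      linarith
  have h5 : min 1 (t / 3) ^ 2 ≤ (s - 1) ^ 2 := by
    rw [← sq_abs (s - 1)]
    exact pow_le_pow_left₀ (le_min zero_le_one (by positivity)) h1 2
  rw [hsy] at hlog ⊢
  nlinarith

lemma log_ggConst_eq {r D : ℝ} (hr : 0 < r) (hD : 0 < D) :
    Real.log (ggConst r D) + 1 / r = (1 / r * Real.log D + Real.log 2 + 1 / r * Real.log (1 + r)) +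
      1 / r * Real.log (Real.Gamma (1 + 1 / r) ^ r * Real.exp 1 / (1 + 1 / r)) := by
  have hG := Real.Gamma_pos_of_pos (show 0 < 1 + 1 / r by positivity)
  have e : 1 + 1 / r = (1 + r) / r := by field_simp; ring
  have e1 : Real.log (ggConst r D) = Real.log 2 + 1 / r * (Real.log r + Real.log D) +
      Real.log (Real.Gamma (1 + 1 / r)) := by
    rw [ggConst, Real.log_mul (by positivity) hG.ne', Real.log_mul (by norm_num) (by positivity),
      Real.log_rpow (by positivity), Real.log_mul hr.ne' hD.ne']
  have e2 : Real.log (Real.Gamma (1 + 1 / r) ^ r * Real.exp 1 / (1 + 1 / r)) =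
      r * Real.log (Real.Gamma (1 + 1 / r)) + 1 - (Real.log (1 + r) - Real.log r) := by
    rw [Real.log_div (by positivity) (by positivity), Real.log_mul (by positivity) (by positivity),
      Real.log_rpow hG, Real.log_exp]
    congr 1
    rw [e, Real.log_div (by positivity) hr.ne']
  rw [e1, e2]
  field_simp
  ring

lemma neg_mul_log_volume_le {f : ℝ → ℝ} {S : Set ℝ} (hf0 : ∀ x, 0 ≤ f x)
    (hf : IntegrableOn f S) (hfl : IntegrableOn (fun x => f x * Real.log (f x)) S)
    (hS : 0 < (volume S).toReal) :
    -((∫ x in S, f x) * Real.log (volume S).toReal) ≤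
      (∫ x in S, f x * Real.log (f x)) + Real.negMulLog (∫ x in S, f x) := by
  have hS' : volume S ≠ ⊤ := fun h => by simp [h] at hS
  have := mul_log_add_le_setIntegral_mul_log (v := fun _ => 1) hf0 hf hfl (fun _ => one_pos)
    (integrableOn_const hS') (by simp) hS (by simp [Measure.real])
  simpa using this

lemma neg_moment_sub_log_ggConst_le {f : ℝ → ℝ} {S : Set ℝ} {r D c : ℝ} (hr : 0 < r) (hD : 0 < D)
    (hf0 : ∀ x, 0 ≤ f x) (hf : IntegrableOn f S)
    (hfl : IntegrableOn (fun x => f x * Real.log (f x)) S)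
    (hfc : IntegrableOn (fun x => f x * |x - c| ^ r) S) :
    -((∫ x in S, f x * |x - c| ^ r) / D / r) - (∫ x in S, f x) * Real.log (ggConst r D) ≤
      (∫ x in S, f x * Real.log (f x)) + Real.negMulLog (∫ x in S, f x) := by
  have hC := ggConst_pos hr hD
  have hgi : Integrable (fun x => ggPdf r D (x - c)) := (integrable_ggPdf hr hD).comp_sub_right c
  have e : (fun x => f x * Real.log (ggPdf r D (x - c))) =
      fun x => (-(1 / (r * D))) * (f x * |x - c| ^ r) - Real.log (ggConst r D) * f x := by
    funext x
    rw [log_ggPdf hr hD]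
    field_simp
  have hfv : IntegrableOn (fun x => f x * Real.log (ggPdf r D (x - c))) S := by
    rw [e]
    exact (hfc.const_mul _).sub (hf.const_mul _)
  have hle : ∫ x in S, ggPdf r D (x - c) ≤ 1 := by
    have h1 : ∫ x, ggPdf r D (x - c) = 1 := by
      rw [integral_sub_right_eq_self (fun x => ggPdf r D x) c, integral_ggPdf hr hD]
    rw [← h1]
    exact setIntegral_le_integral hgi (Eventually.of_forall fun x => (ggPdf_pos hr hD _).le)
  have := mul_log_add_le_setIntegral_mul_log hf0 hf hfl (fun x => ggPdf_pos hr hD (x - c))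
    hgi.integrableOn hfv one_pos hle
  rw [Real.log_one, mul_zero, sub_zero, e, integral_sub (hfc.const_mul _) (hf.const_mul _),
    integral_const_mul, integral_const_mul] at this
  refine le_trans (le_of_eq ?_) this
  field_simp

lemma mass_mul_le_moment {f : ℝ → ℝ} {S : Set ℝ} {r D c τ : ℝ} (hr : 0 < r) (hD : 0 < D)
    (hf0 : ∀ x, 0 ≤ f x) (hf : IntegrableOn f S)
    (hfc : IntegrableOn (fun x => f x * |x - c| ^ r) S) (hS : 0 < (volume S).toReal)
    (hgood : ∫ x in S, |f x - (∫ x in S, f x) / (volume S).toReal| ≤ τ * ∫ x in S, f x) :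
    (∫ x in S, f x) * ((volume S).toReal ^ r / D / (2 ^ r * (1 + r))) * (1 - τ * (1 + r)) ≤
      (∫ x in S, f x * |x - c| ^ r) / D := by
  have hS' : volume S ≠ ⊤ := fun h => by simp [h] at hS
  set p := ∫ x in S, f x
  set Δ := (volume S).toReal
  have hp0 : 0 ≤ p := integral_nonneg hf0
  have h := rpow_mul_setIntegral_sub_le (u := p / Δ) (c := c) hr (show 0 ≤ Δ / 2 by positivity)
    (by positivity) hS' hf0 hf hfc
  have h1 : (Δ / 2) ^ r * (∫ x in S, |f x - p / Δ|) ≤ (Δ / 2) ^ r * (τ * p) := by gcongr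
  rw [le_div_iff₀ hD]
  refine le_trans ?_ ((sub_le_sub_left h1 _).trans h)
  rw [Real.div_rpow hS.le (by norm_num)]
  apply le_of_eq
  have : (0 : ℝ) < 2 ^ r := by positivity
  have hr1 : 1 + r ≠ 0 := by positivity
  have hr2 : r + 1 ≠ 0 := by positivity
  field_simp
  ring

/-- The excess of the rate of a single cell, as a function of its distortion and its length. -/
lemma cell_deviation_le {f : ℝ → ℝ} {S : Set ℝ} {r D c τ ϑ : ℝ} (hr : 0 < r) (hD : 0 < D)
    (hτ : 0 ≤ τ) (hτ1 : τ * (1 + r) < 1) (hϑ : 0 < ϑ)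
    (hf0 : ∀ x, 0 ≤ f x) (hf : IntegrableOn f S)
    (hfl : IntegrableOn (fun x => f x * Real.log (f x)) S)
    (hfc : IntegrableOn (fun x => f x * |x - c| ^ r) S) (hS : 0 < (volume S).toReal)
    {b : ℝ} (hb0 : 0 ≤ b)
    (hb : τ * (∫ x in S, f x) < (∫ x in S, |f x - (∫ x in S, f x) / (volume S).toReal|) →
      (∫ x in S, f x) ≤ b) :
    min 1 (ϑ / (2 ^ r * (1 + r)) / 3) ^ 2 / r * ((∫ x in S, f x) -
        (∫ x in S, f x) * (if |(volume S).toReal ^ r / D - 2 ^ r * (1 + r)| ≤ ϑ then 1 else 0)) ≤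
      (∫ x in S, f x * Real.log (f x)) + Real.negMulLog (∫ x in S, f x) +
      (∫ x in S, f x) * (1 / r * Real.log D + Real.log 2 + 1 / r * Real.log (1 + r)) +
      1 / r * ((∫ x in S, f x * |x - c| ^ r) / D / (1 - τ * (1 + r)) - ∫ x in S, f x) +
      (1 / r * Real.log (Real.Gamma (1 + 1 / r) ^ r * Real.exp 1 / (1 + 1 / r)) +
        min 1 (ϑ / (2 ^ r * (1 + r)) / 3) ^ 2 / r) * b := by
  have hγ := log_spaceFilling_pos hr
  have hlc := log_ggConst_eq hr hD
  have hgg := neg_moment_sub_log_ggConst_le hr hD hf0 hf hfl hfc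
  have hun := neg_mul_log_volume_le hf0 hf hfl hS
  have hgm := mass_mul_le_moment (τ := τ) hr hD hf0 hf hfc hS
  have hW0 : 0 ≤ (∫ x in S, f x * |x - c| ^ r) / D :=
    div_nonneg (integral_nonneg fun x => mul_nonneg (hf0 x) (by positivity)) hD.le
  set p := ∫ x in S, f x
  set Δ := (volume S).toReal
  set γ := 1 / r * Real.log (Real.Gamma (1 + 1 / r) ^ r * Real.exp 1 / (1 + 1 / r))
  set T := (∫ x in S, f x * Real.log (f x)) + Real.negMulLog p
  set W := (∫ x in S, f x * |x - c| ^ r) / D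
  set κ := 1 / r * Real.log D + Real.log 2 + 1 / r * Real.log (1 + r) with hκ
  set L : ℝ := 2 ^ r * (1 + r) with hL
  have hL0 : 0 < L := by positivity
  set ψ := min 1 (ϑ / L / 3) ^ 2
  have hψ0 : 0 ≤ ψ := by positivity
  have hp0 : 0 ≤ p := integral_nonneg hf0
  have hε : 0 < 1 - τ * (1 + r) := by linarith
  by_cases hgood : ∫ x in S, |f x - p / Δ| ≤ τ * p
  · have hgm := hgm hgood
    set y := Δ ^ r / D / L with hy
    have hy0 : 0 < y := by positivity
    have hW : p * y ≤ W / (1 - τ * (1 + r)) := by rwa [le_div_iff₀ hε]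
    have hlogy : Real.log y = r * (Real.log Δ - κ) := by
      rw [hy, hL, Real.log_div (by positivity) (by positivity), Real.log_div (by positivity) hD.ne',
        Real.log_rpow hS, Real.log_mul (by positivity) (by positivity), Real.log_rpow (by norm_num),
        hκ]
      field_simp
      ring
    have hdev : ψ * (p - p * (if |Δ ^ r / D - L| ≤ ϑ then 1 else 0)) ≤
        p * (y - 1 - Real.log y) := by
      split_ifs with h
      · have := Real.log_le_sub_one_of_pos hy0
        nlinarith
      · have h1 : ϑ / L < |y - 1| := by
          have : y - 1 = (Δ ^ r / D - L) / L := by rw [hy]; field_simp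
          rw [this, abs_div, abs_of_pos hL0]
          gcongr
          exact not_le.1 h
        have := min_sq_le_sub_one_sub_log hy0 (by positivity) h1
        nlinarith
    have h2 : 1 / r * (ψ * (p - p * (if |Δ ^ r / D - L| ≤ ϑ then 1 else 0))) ≤
        1 / r * (p * (y - 1 - Real.log y)) := by gcongr
    have h3 : 1 / r * (p * y) ≤ 1 / r * (W / (1 - τ * (1 + r))) := by gcongr
    have h4 : 1 / r * (p * Real.log y) = p * (Real.log Δ - κ) := by
      rw [hlogy]; field_simp
    have h5 : 0 ≤ (γ + ψ / r) * b := by positivity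
    have h6 : ψ / r * (p - p * (if |Δ ^ r / D - L| ≤ ϑ then 1 else 0)) =
        1 / r * (ψ * (p - p * (if |Δ ^ r / D - L| ≤ ϑ then 1 else 0))) := by ring
    rw [h6]
    linarith
  · have hpb := hb (not_le.1 hgood)
    have h1 : p - p * (if |Δ ^ r / D - L| ≤ ϑ then 1 else 0) ≤ p := by
      split_ifs <;> linarith
    have h2 : ψ / r * (p - p * (if |Δ ^ r / D - L| ≤ ϑ then 1 else 0)) ≤ ψ / r * p := by gcongr
    have h3 : (γ + ψ / r) * p ≤ (γ + ψ / r) * b := by gcongr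
    have h4 : W ≤ W / (1 - τ * (1 + r)) := by
      rw [le_div_iff₀ hε]
      nlinarith [mul_nonneg hτ (show 0 ≤ 1 + r by positivity)]
    have h5 : 1 / r * W ≤ 1 / r * (W / (1 - τ * (1 + r))) := by gcongr
    have h6 : p * Real.log (ggConst r D) = p * κ + p * γ - 1 / r * p := by
      rw [eq_sub_of_add_eq hlc]; ring
    have h7 : W / r = 1 / r * W := by ring
    linarith

lemma setIntegral_abs_sub_average_le {f : ℝ → ℝ} {S : Set ℝ} (hf : IntegrableOn f S)
    (hS : 0 < (volume S).toReal) (k : ℝ) :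
    ∫ x in S, |f x - (∫ x in S, f x) / (volume S).toReal| ≤ 2 * ∫ x in S, |f x - k| := by
  have hS' : volume S ≠ ⊤ := fun h => by simp [h] at hS
  set u := (∫ x in S, f x) / (volume S).toReal with hu
  have hk : IntegrableOn (fun _ : ℝ => k) S := integrableOn_const hS'
  have hku : IntegrableOn (fun _ : ℝ => |k - u|) S := integrableOn_const hS'
  have hfk : IntegrableOn (fun x => |f x - k|) S := (hf.sub hk).norm
  have hfu : IntegrableOn (fun x => |f x - u|) S := (hf.sub (integrableOn_const hS')).norm
  have h1 : ∫ x in S, |f x - u| ≤ ∫ x in S, (|f x - k| + |k - u|) :=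
    integral_mono hfu (hfk.add hku) fun x => abs_sub_le _ _ _
  have h2 : ∫ x in S, (f x - k) = -((volume S).toReal * (k - u)) := by
    rw [integral_sub hf hk, setIntegral_const, hu, measureReal_def, smul_eq_mul]
    field_simp
    ring
  have h3 : (volume S).toReal * |k - u| ≤ ∫ x in S, |f x - k| := by
    have := abs_integral_le_integral_abs (f := fun x => f x - k) (μ := volume.restrict S)
    rwa [h2, abs_neg, abs_mul, abs_of_pos hS] at this
  rw [integral_add hfk hku, setIntegral_const, measureReal_def, smul_eq_mul] at h1
  linarith

section Approximation

variable {f g : ℝ → ℝ} {M G ω δ : ℝ}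

lemma setIntegral_abs_sub_average_le_of_short {S : Set ℝ} {c : ℝ}
    (hf : IntegrableOn f S) (hg : Integrable g) (hgM : ∀ x, M < |x| → g x = 0)
    (hω : ∀ x y, |x - y| ≤ δ → |g x - g y| ≤ ω) (hδ1 : δ ≤ 1)
    (hS : 0 < (volume S).toReal) (hc : ∀ᵐ x ∂(volume.restrict S), |x - c| ≤ δ) :
    ∫ x in S, |f x - (∫ x in S, f x) / (volume S).toReal| ≤
      2 * ((∫ x in S, |f x - g x|) + ω * (volume.restrict S).real (Icc (-(M + 2)) (M + 2))) := by
  have hS' : volume S ≠ ⊤ := fun h => by simp [h] at hS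
  have : IsFiniteMeasure (volume.restrict S) := isFiniteMeasure_restrict.2 hS'
  refine (setIntegral_abs_sub_average_le hf hS (g c)).trans ?_
  have hind : Integrable ((Icc (-(M + 2)) (M + 2)).indicator fun _ => ω) (volume.restrict S) :=
    (integrable_const ω).indicator measurableSet_Icc
  have hfg : IntegrableOn (fun x => |f x - g x|) S := (hf.sub hg.integrableOn).norm
  have h1 : ∫ x in S, |f x - g c| ≤
      ∫ x in S, (|f x - g x| + (Icc (-(M + 2)) (M + 2)).indicator (fun _ => ω) x) := by
    refine integral_mono_ae (hf.sub (integrableOn_const hS')).norm (hfg.add hind) ?_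
    filter_upwards [hc] with x hx
    refine (abs_sub_le _ (g x) _).trans (add_le_add_right ?_ _)
    by_cases hxK : x ∈ Icc (-(M + 2)) (M + 2)
    · rw [indicator_of_mem hxK]
      exact hω _ _ hx
    · rw [indicator_of_notMem hxK]
      have h2 : M + 2 < |x| := by
        by_contra h
        exact hxK (abs_le.1 (not_lt.1 h))
      have h3 : M < |c| := by
        have := abs_sub_abs_le_abs_sub x c
        linarith
      rw [hgM x (by linarith), hgM c h3]
      simp
  rw [integral_add hfg hind, integral_indicator_const _ measurableSet_Icc, smul_eq_mul] at h1
  linarith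

lemma mass_le_of_long {S : Set ℝ} {a b c s r : ℝ}
    (hSab : S =ᵐ[volume] Ico a b) (hc : c ∈ Ico a b) (hf0 : ∀ x, 0 ≤ f x)
    (hf : IntegrableOn f S) (hr : 0 < r) (hfc : IntegrableOn (fun x => f x * |x - c| ^ r) S)
    (hg : Integrable g) (hgM : ∀ x, M < |x| → g x = 0) (hG : ∀ x, |g x| ≤ G)
    (hδ : 0 < δ) (hδ1 : δ ≤ 1) (hs : 0 < s) (hs1 : s ≤ 1) (hab : δ < b - a) :
    ∫ x in S, f x ≤ (∫ x in S, |f x - g x|) +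
      G * (2 * s / δ) * (volume.restrict S).real (Icc (-(M + 2)) (M + 2)) +
      (∫ x in S, f x * |x - c| ^ r) / s ^ r := by
  have hG0 : 0 ≤ G := (abs_nonneg _).trans (hG 0)
  have hfg : IntegrableOn (fun x => |f x - g x|) S := (hf.sub hg.integrableOn).norm
  have hS' : volume S ≠ ⊤ := by
    rw [measure_congr hSab]; simp
  have : IsFiniteMeasure (volume.restrict S) := isFiniteMeasure_restrict.2 hS'
  set k : ℝ → ℝ := (Icc (c - s) (c + s)).indicator fun x => |g x| with hk
  have hki : Integrable k := hg.norm.indicator measurableSet_Icc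
  have key : ∀ x, f x ≤ |f x - g x| + k x + f x * |x - c| ^ r / s ^ r := by
    intro x
    have h0 : 0 ≤ f x * |x - c| ^ r / s ^ r := by have := hf0 x; positivity
    by_cases hx : x ∈ Icc (c - s) (c + s)
    · rw [hk, indicator_of_mem hx]
      have h1 := le_abs_self (f x - g x)
      have h2 := le_abs_self (g x)
      linarith
    · rw [hk, indicator_of_notMem hx]
      have h1 : s ≤ |x - c| := by
        by_contra h
        have := abs_lt.1 (not_le.1 h)
        exact hx ⟨by linarith, by linarith⟩
      have h2 : s ^ r ≤ |x - c| ^ r := Real.rpow_le_rpow hs.le h1 hr.le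
      have h3 : f x ≤ f x * |x - c| ^ r / s ^ r := by
        rw [le_div_iff₀ (by positivity)]
        exact mul_le_mul_of_nonneg_left h2 (hf0 x)
      have := abs_nonneg (f x - g x)
      linarith
  have h1 := integral_mono (μ := volume.restrict S) hf
    ((hfg.add hki.integrableOn).add (hfc.div_const (s ^ r))) key
  rw [integral_add' (hfg.add hki.integrableOn) (hfc.div_const _),
    integral_add' hfg hki.integrableOn, integral_div] at h1
  have h2 : ∫ x in S, k x ≤
      G * (2 * s / δ) * (volume.restrict S).real (Icc (-(M + 2)) (M + 2)) := by
    by_cases hcM : |c| ≤ M + 1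
    · have h3 : ∫ x in S, k x ≤ G * (2 * s) := by
        calc ∫ x in S, k x ≤ ∫ x, k x := setIntegral_le_integral hki
              (Eventually.of_forall fun x => indicator_nonneg (fun x _ => abs_nonneg _) x)
          _ = ∫ x in Icc (c - s) (c + s), |g x| := integral_indicator measurableSet_Icc
          _ ≤ ∫ x in Icc (c - s) (c + s), G :=
              integral_mono hg.norm.integrableOn (integrableOn_const (by simp)) hG
          _ = G * (2 * s) := by
              rw [setIntegral_const, measureReal_def, Real.volume_Icc,
                ENNReal.toReal_ofReal (by linarith), smul_eq_mul]
              ring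
      have h4 : δ ≤ (volume.restrict S).real (Icc (-(M + 2)) (M + 2)) := by
        rw [measureReal_restrict_apply measurableSet_Icc, measureReal_def,
          measure_congr ((ae_eq_refl _).inter hSab), ← measureReal_def]
        have h5 : Ico (max a (c - δ)) (max a (c - δ) + δ) ⊆
            Icc (-(M + 2)) (M + 2) ∩ Ico a b := by
          intro x hx
          have hcab := hc
          simp only [mem_Ico, max_le_iff] at hx hcab
          have h6 := abs_le.1 hcM
          obtain ⟨⟨h7, h8⟩, h9⟩ := hx
          rcases max_cases a (c - δ) with h | h <;> rw [h.1] at h9 <;>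
            refine ⟨⟨?_, ?_⟩, h7, ?_⟩ <;> linarith
        have h6 := measureReal_mono h5
          (measure_inter_lt_top_of_left_ne_top (measure_Icc_lt_top (μ := volume)).ne).ne
        rw [measureReal_def, Real.volume_Ico, ENNReal.toReal_ofReal (by linarith)] at h6
        linarith
      calc ∫ x in S, k x ≤ G * (2 * s) := h3
        _ = G * (2 * s / δ) * δ := by field_simp
        _ ≤ _ := by gcongr
    · have h3 : ∀ x, k x = 0 := by
        intro x
        refine indicator_apply_eq_zero.2 fun hx => ?_
        rw [hgM x, abs_zero]
        have h4 := abs_sub_abs_le_abs_sub c x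
        have h5 : |c - x| ≤ s := abs_le.2 ⟨by linarith [hx.2], by linarith [hx.1]⟩
        linarith [not_le.1 hcM]
      simp only [h3, integral_zero]
      positivity
  linarith

end Approximation

section Cells

variable {μ : Measure ℝ} {f : ℝ → ℝ} {q : Quantizer ℝ}

lemma Quantizer.hasSum_setIntegral (q : Quantizer ℝ) {F : ℝ → ℝ} (hF : Integrable F) :
    HasSum (fun i => ∫ x in q.S i, F x) (∫ x, F x) := by
  have := hasSum_integral_iUnion q.meas q.disj (f := F) (μ := volume) hF.integrableOn
  rwa [q.cover, setIntegral_univ] at this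

lemma toReal_apply_eq_setIntegral (hfm : Measurable f) (hf0 : ∀ x, 0 ≤ f x)
    (hμf : μ = volume.withDensity fun x => ENNReal.ofReal (f x)) {S : Set ℝ}
    (hS : MeasurableSet S) : (μ S).toReal = ∫ x in S, f x := by
  rw [hμf, withDensity_apply _ hS, integral_eq_lintegral_of_nonneg_ae
    (Eventually.of_forall hf0) hfm.aestronglyMeasurable]

lemma integrable_density [IsFiniteMeasure μ] (hfm : Measurable f) (hf0 : ∀ x, 0 ≤ f x)
    (hμf : μ = volume.withDensity fun x => ENNReal.ofReal (f x)) : Integrable f := by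
  have := (integrable_density_iff hfm hf0 hμf (g := fun _ => 1)).1 (integrable_const _)
  simpa using this

lemma Quantizer.moment_summable (hfm : Measurable f) (hf0 : ∀ x, 0 ≤ f x)
    (hμf : μ = volume.withDensity fun x => ENNReal.ofReal (f x)) {r D : ℝ} (hD : 0 < D)
    (hdist : q.distortion μ (fun x => |x|) r ≤ ENNReal.ofReal D) :
    (∀ i, IntegrableOn (fun x => f x * |x - q.c i| ^ r) (q.S i)) ∧
    Summable (fun i => ∫ x in q.S i, f x * |x - q.c i| ^ r) ∧
    ∑' i, ∫ x in q.S i, f x * |x - q.c i| ^ r ≤ D := by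
  have e : ∀ i, ∫⁻ x in q.S i, ENNReal.ofReal (|x - q.c i| ^ r) ∂μ =
      ∫⁻ x in q.S i, ENNReal.ofReal (f x * |x - q.c i| ^ r) := by
    intro i
    rw [hμf, setLIntegral_withDensity_eq_setLIntegral_mul _ (by fun_prop) (by fun_prop) (q.meas i)]
    exact lintegral_congr fun x => by simp [ENNReal.ofReal_mul (hf0 x)]
  unfold Quantizer.distortion at hdist
  simp only [e] at hdist
  have hne : ∑' i, ∫⁻ x in q.S i, ENNReal.ofReal (f x * |x - q.c i| ^ r) ≠ ⊤ :=
    (hdist.trans_lt ENNReal.ofReal_lt_top).ne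
  have h0 : ∀ i x, 0 ≤ f x * |x - q.c i| ^ r := fun i x => mul_nonneg (hf0 x) (by positivity)
  have hme : ∀ i, Measurable fun x => f x * |x - q.c i| ^ r := fun i => by fun_prop
  have e2 : ∀ i, ∫ x in q.S i, f x * |x - q.c i| ^ r =
      (∫⁻ x in q.S i, ENNReal.ofReal (f x * |x - q.c i| ^ r)).toReal := fun i =>
    integral_eq_lintegral_of_nonneg_ae (Eventually.of_forall (h0 i))
      (hme i).aestronglyMeasurable
  refine ⟨fun i => ?_, ?_, ?_⟩
  · refine ⟨(hme i).aestronglyMeasurable, ?_⟩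
    rw [hasFiniteIntegral_iff_ofReal (Eventually.of_forall (h0 i))]
    exact (ENNReal.ne_top_of_tsum_ne_top hne i).lt_top
  · simp only [e2]
    exact ENNReal.summable_toReal hne
  · simp only [e2]
    rw [← ENNReal.tsum_toReal_eq (ENNReal.ne_top_of_tsum_ne_top hne)]
    exact ENNReal.toReal_le_of_le_ofReal hD.le hdist

/-- The mass of the cells of length far from the optimal one is controlled by the excess rate. -/
lemma Quantizer.deviation_le [IsProbabilityMeasure μ] {r D τ ϑ : ℝ} (hr : 0 < r) (hD : 0 < D)
    (hτ : 0 < τ) (hτ1 : τ * (1 + r) < 1) (hϑ : 0 < ϑ)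
    (hfm : Measurable f) (hf0 : ∀ x, 0 ≤ f x)
    (hμf : μ = volume.withDensity fun x => ENNReal.ofReal (f x))
    (hent : Integrable (fun x => f x * Real.log (f x)))
    (hreg : ∃ Sbar : Set ℝ, volume Sbar = 0 ∧
      ∀ i, ∃ a b : ℝ, q.S i \ Sbar = Set.Ico a b \ Sbar ∧ q.c i ∈ Set.Ico a b)
    (hdist : q.distortion μ (fun x => |x|) r ≤ ENNReal.ofReal D)
    (hsum : Summable fun i => Real.negMulLog (μ (q.S i)).toReal)
    {g : ℝ → ℝ} {M G ω δ s : ℝ} (hg : Integrable g) (hM : 0 ≤ M) (hgM : ∀ x, M < |x| → g x = 0)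
    (hG : ∀ x, |g x| ≤ G) (hω : ∀ x y, |x - y| ≤ δ → |g x - g y| ≤ ω) (hω0 : 0 ≤ ω)
    (hδ : 0 < δ) (hδ1 : δ ≤ 1) (hs : 0 < s) (hs1 : s ≤ 1) :
    min 1 (ϑ / (2 ^ r * (1 + r)) / 3) ^ 2 / r * (1 - ∑' i : ℤ, (μ (q.S i)).toReal *
        (if |(volume (q.S i)).toReal ^ r / D - 2 ^ r * (1 + r)| ≤ ϑ then 1 else 0)) ≤
      (q.entropyR μ + (∫ x, f x * Real.log (f x)) +
        (1 / r * Real.log D + Real.log 2 + 1 / r * Real.log (1 + r))) +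
      1 / r * (1 / (1 - τ * (1 + r)) - 1) +
      (1 / r * Real.log (Real.Gamma (1 + 1 / r) ^ r * Real.exp 1 / (1 + 1 / r)) +
        min 1 (ϑ / (2 ^ r * (1 + r)) / 3) ^ 2 / r) *
      (2 / τ * ((∫ x, |f x - g x|) + ω * (2 * (M + 2))) +
        ((∫ x, |f x - g x|) + G * (2 * s / δ) * (2 * (M + 2)) + D / s ^ r)) := by
  have hf := integrable_density hfm hf0 hμf
  have hG0 : 0 ≤ G := (abs_nonneg _).trans (hG 0)
  have hε : 0 < 1 - τ * (1 + r) := by linarith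
  have hγ := log_spaceFilling_pos hr
  obtain ⟨hmi, hms, hmD⟩ := Quantizer.moment_summable hfm hf0 hμf hD hdist
  have hp : ∀ i, (μ (q.S i)).toReal = ∫ x in q.S i, f x := fun i =>
    toReal_apply_eq_setIntegral hfm hf0 hμf (q.meas i)
  unfold Quantizer.entropyR
  simp only [hp] at hsum ⊢
  set γ := 1 / r * Real.log (Real.Gamma (1 + 1 / r) ^ r * Real.exp 1 / (1 + 1 / r))
  set κ := 1 / r * Real.log D + Real.log 2 + 1 / r * Real.log (1 + r)
  set ψ := min 1 (ϑ / (2 ^ r * (1 + r)) / 3) ^ 2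
  set m : ℤ → ℝ := fun i => ∫ x in q.S i, f x * |x - q.c i| ^ r
  set d : ℤ → ℝ := fun i => ∫ x in q.S i, |f x - g x|
  set v : ℤ → ℝ := fun i => (volume.restrict (q.S i)).real (Icc (-(M + 2)) (M + 2)) with hv
  set p : ℤ → ℝ := fun i => ∫ x in q.S i, f x
  set I : ℤ → ℝ := fun i =>
    if |(volume (q.S i)).toReal ^ r / D - 2 ^ r * (1 + r)| ≤ ϑ then 1 else 0
  have hI : ∀ i, 0 ≤ I i ∧ I i ≤ 1 := fun i => by
    simp only [I]; split_ifs <;> norm_num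
  have hψ0 : 0 ≤ ψ := by positivity
  have hp0 : ∀ i, 0 ≤ p i := fun i => integral_nonneg hf0
  have hd0 : ∀ i, 0 ≤ d i := fun i => integral_nonneg fun x => abs_nonneg _
  have hv0 : ∀ i, 0 ≤ v i := fun i => measureReal_nonneg
  have hm0 : ∀ i, 0 ≤ m i := fun i =>
    integral_nonneg fun x => mul_nonneg (hf0 x) (by positivity)
  have hpS : HasSum p 1 := by
    have h1 := q.hasSum_setIntegral hf
    have h2 : ∫ x, f x = 1 := by
      rw [← setIntegral_univ, ← toReal_apply_eq_setIntegral hfm hf0 hμf MeasurableSet.univ]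
      simp
    rwa [h2] at h1
  have hdS : HasSum d (∫ x, |f x - g x|) := q.hasSum_setIntegral (hf.sub hg).norm
  have hvS : HasSum v (2 * (M + 2)) := by
    have h1 := q.hasSum_setIntegral (F := (Icc (-(M + 2)) (M + 2)).indicator fun _ => (1 : ℝ))
      ((integrable_indicator_iff measurableSet_Icc).2 (integrableOn_const (by simp)))
    have h2 : ∀ i, ∫ x in q.S i, (Icc (-(M + 2)) (M + 2)).indicator (fun _ => (1 : ℝ)) x =
        v i := fun i => by
      rw [integral_indicator_const _ measurableSet_Icc, smul_eq_mul, mul_one]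
    simp only [h2] at h1
    rw [integral_indicator_const _ measurableSet_Icc, smul_eq_mul, mul_one, measureReal_def,
      Real.volume_Icc, ENNReal.toReal_ofReal (by linarith)] at h1
    convert h1 using 1
    ring
  have hlS := q.hasSum_setIntegral hent
  have hpI : Summable fun i => p i * I i :=
    hpS.summable.of_nonneg_of_le (fun i => mul_nonneg (hp0 i) (hI i).1)
      fun i => mul_le_of_le_one_right (hp0 i) (hI i).2
  set b : ℤ → ℝ := fun i => 2 / τ * (d i + ω * v i) +
    (d i + G * (2 * s / δ) * v i + m i / s ^ r) with hb
  have hcell : ∀ i, ψ / r * (p i - p i * I i) ≤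
      (∫ x in q.S i, f x * Real.log (f x)) + Real.negMulLog (p i) + p i * κ +
      1 / r * (m i / D / (1 - τ * (1 + r)) - p i) + (γ + ψ / r) * b i := by
    intro i
    obtain ⟨Sbar, hSbar, hS⟩ := hreg
    obtain ⟨x₀, y₀, hxy, hc⟩ := hS i
    have hSab : q.S i =ᵐ[volume] Ico x₀ y₀ := by
      have h0 : ∀ᵐ x, x ∉ Sbar := measure_eq_zero_iff_ae_notMem.1 hSbar
      filter_upwards [h0] with x hx
      have h1 := Set.ext_iff.1 hxy x
      simp only [Set.mem_sdiff, hx, not_false_eq_true, and_true] at h1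
      exact propext h1
    have hlt : x₀ < y₀ := hc.1.trans_lt hc.2
    have hvol : (volume (q.S i)).toReal = y₀ - x₀ := by
      rw [measure_congr hSab, Real.volume_Ico, ENNReal.toReal_ofReal (by linarith)]
    have hvpos : 0 < (volume (q.S i)).toReal := by rw [hvol]; linarith
    have h1 : 0 ≤ 2 / τ * (d i + ω * v i) := by have := hd0 i; have := hv0 i; positivity
    have h2 : 0 ≤ d i + G * (2 * s / δ) * v i + m i / s ^ r := by
      have := hd0 i; have := hv0 i; have := hm0 i; positivity
    refine cell_deviation_le (c := q.c i) hr hD hτ.le hτ1 hϑ hf0 hf.integrableOn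
      hent.integrableOn (hmi i) hvpos (add_nonneg h1 h2) fun hbad => ?_
    rcases le_or_gt (y₀ - x₀) δ with hshort | hlong
    · have hcl : ∀ᵐ x ∂(volume.restrict (q.S i)), |x - q.c i| ≤ δ := by
        rw [ae_restrict_iff' (q.meas i)]
        filter_upwards [hSab] with x hx hxS
        have hx' : x ∈ Ico x₀ y₀ := hx.mp hxS
        rw [abs_le]
        constructor <;> linarith [hx'.1, hx'.2, hc.1, hc.2]
      have h3 := setIntegral_abs_sub_average_le_of_short hf.integrableOn hg hgM hω hδ1 hvpos hcl
      have h4 := hbad.le.trans h3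
      have h5 : p i ≤ 2 / τ * (d i + ω * v i) := by
        rw [div_mul_eq_mul_div, le_div_iff₀ hτ, mul_comm]
        exact h4
      exact h5.trans (le_add_of_nonneg_right h2)
    · exact (mass_le_of_long hSab hc hf0 hf.integrableOn hr (hmi i) hg hgM hG hδ hδ1 hs hs1
        hlong).trans (le_add_of_nonneg_left h1)
  have hbS : HasSum b (2 / τ * ((∫ x, |f x - g x|) + ω * (2 * (M + 2))) +
      ((∫ x, |f x - g x|) + G * (2 * s / δ) * (2 * (M + 2)) + (∑' i, m i) / s ^ r)) :=
    ((hdS.add (hvS.mul_left ω)).mul_left _).add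
      ((hdS.add (hvS.mul_left _)).add (hms.hasSum.div_const _))
  have hR := (((hlS.add hsum.hasSum).add (hpS.mul_right κ)).add
    ((((hms.hasSum.div_const D).div_const (1 - τ * (1 + r))).sub hpS).mul_left (1 / r))).add
    (hbS.mul_left (γ + ψ / r))
  have hL := (hpS.sub hpI.hasSum).mul_left (ψ / r)
  have hfin := hasSum_le hcell hL hR
  refine hfin.trans ?_
  have h1 : (∑' i, m i) / D / (1 - τ * (1 + r)) ≤ 1 / (1 - τ * (1 + r)) := by
    gcongr
    rwa [div_le_one hD]
  have h2 : (∑' i, m i) / s ^ r ≤ D / s ^ r := by gcongr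
  have h3 : 1 / r * ((∑' i, m i) / D / (1 - τ * (1 + r)) - 1) ≤
      1 / r * (1 / (1 - τ * (1 + r)) - 1) := by gcongr
  have h4 : (γ + ψ / r) * (2 / τ * ((∫ x, |f x - g x|) + ω * (2 * (M + 2))) +
      ((∫ x, |f x - g x|) + G * (2 * s / δ) * (2 * (M + 2)) + (∑' i, m i) / s ^ r)) ≤
      (γ + ψ / r) * (2 / τ * ((∫ x, |f x - g x|) + ω * (2 * (M + 2))) +
      ((∫ x, |f x - g x|) + G * (2 * s / δ) * (2 * (M + 2)) + D / s ^ r)) := by gcongr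
  linarith

end Cells

/-- The data of a uniformly continuous, bounded, compactly supported approximation in `L¹`. -/
lemma exists_uniform_approximation {f : ℝ → ℝ} (hf : Integrable f) {η : ℝ} (hη : 0 < η) :
    ∃ (g : ℝ → ℝ) (M G : ℝ), Integrable g ∧ 0 ≤ M ∧ (∀ x, M < |x| → g x = 0) ∧
      (∀ x, |g x| ≤ G) ∧ (∫ x, |f x - g x|) ≤ η ∧
      ∀ ω, 0 < ω → ∃ δ, 0 < δ ∧ δ ≤ 1 ∧ ∀ x y, |x - y| ≤ δ → |g x - g y| ≤ ω := by
  obtain ⟨g, hgs, hg1, hgc, hgi⟩ := hf.exists_hasCompactSupport_integral_sub_le hη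
  obtain ⟨M, hM⟩ := hgs.isCompact.isBounded.subset_closedBall 0
  obtain ⟨G, hG⟩ := hgs.exists_bound_of_continuous hgc
  refine ⟨g, max M 0, G, hgi, le_max_right _ _, fun x hx => ?_, hG, hg1, fun ω hω => ?_⟩
  · refine image_eq_zero_of_notMem_tsupport fun h => ?_
    have := hM h
    rw [mem_closedBall_zero_iff, Real.norm_eq_abs] at this
    exact absurd (this.trans (le_max_left M 0)) (not_le.2 hx)
  · obtain ⟨δ, hδ, h⟩ := Metric.uniformContinuous_iff.1
      (hgs.uniformContinuous_of_continuous hgc) ω hω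
    refine ⟨min (δ / 2) 1, by positivity, min_le_right _ _, fun x y hxy => ?_⟩
    have h1 : dist x y < δ := by
      rw [Real.dist_eq]
      linarith [min_le_left (δ / 2) 1]
    exact (h h1).le

lemma frequently_lt_of_liminf_eq {u : ℝ → ℝ} {F : Filter ℝ} {γ : ℝ} (hγ : 0 < γ)
    (h : liminf u F = γ) : (∀ᶠ D in F, 0 < u D) ∧ ∀ ε, 0 < ε → ∃ᶠ D in F, u D < γ + ε := by
  rw [liminf_eq] at h
  have hne : {a | ∀ᶠ n in F, a ≤ u n}.Nonempty := by
    by_contra h'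
    rw [not_nonempty_iff_eq_empty.1 h', Real.sSup_empty] at h
    exact hγ.ne h
  have hbdd : BddAbove {a | ∀ᶠ n in F, a ≤ u n} := by
    by_contra h'
    rw [Real.sSup_of_not_bddAbove h'] at h
    exact hγ.ne h
  refine ⟨?_, fun ε hε h' => ?_⟩
  · obtain ⟨a, ha, ha0⟩ := exists_lt_of_lt_csSup hne (show 0 < sSup _ by rwa [h])
    filter_upwards [ha] with D hD
    exact ha0.trans_le hD
  · have h1 : γ + ε ∈ {a | ∀ᶠ n in F, a ≤ u n} := by
      filter_upwards [h'] with D hD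
      exact not_lt.1 hD
    have h2 := le_csSup hbdd h1
    rw [h] at h2
    linarith

lemma frequently_deviation_le {r : ℝ} (hr : 0 < r)
    (μ : Measure ℝ) [IsProbabilityMeasure μ]
    (f : ℝ → ℝ) (hfm : Measurable f) (hf0 : ∀ x, 0 ≤ f x)
    (hμf : μ = volume.withDensity fun x => ENNReal.ofReal (f x))
    (hent : Integrable (fun x => f x * Real.log (f x)))
    (hfloor : Summable fun k : ℤ => Real.negMulLog (μ {x | ⌊x⌋ = k}).toReal)
    (q : ℝ → Quantizer ℝ)
    (hreg : ∀ D, 0 < D → ∃ Sbar : Set ℝ, volume Sbar = 0 ∧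
      ∀ i, ∃ a b : ℝ, (q D).S i \ Sbar = Set.Ico a b \ Sbar ∧ (q D).c i ∈ Set.Ico a b)
    (hdist : ∀ D, 0 < D → (q D).distortion μ (fun x => |x|) r ≤ ENNReal.ofReal D)
    (hach : Filter.liminf
        (fun D => (q D).entropyR μ - (RDfun μ (fun x => |x|) r D).toReal) (𝓝[>] (0:ℝ))
      = (1 / r) * Real.log (Real.Gamma (1 + 1 / r) ^ r * Real.exp 1 / (1 + 1 / r)))
    {ϑ : ℝ} (hϑ : 0 < ϑ) {ε : ℝ} (hε : 0 < ε) :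
    ∃ᶠ D in 𝓝[>] (0 : ℝ), 1 - ε ≤ ∑' i : ℤ, (μ ((q D).S i)).toReal *
      (if |(volume ((q D).S i)).toReal ^ r / D - 2 ^ r * (1 + r)| ≤ ϑ then 1 else 0) := by
  have hγ := log_spaceFilling_pos hr
  obtain ⟨hpos, hfreq⟩ := frequently_lt_of_liminf_eq hγ hach
  have hlc := fun D => log_ggConst_eq (D := D) hr
  have hdev := fun D hD τ hτ hτ1 => Quantizer.deviation_le (q := q D) (D := D) (τ := τ)
    hr hD hτ hτ1 hϑ hfm hf0 hμf hent (hreg D hD) (hdist D hD)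
  set γ := 1 / r * Real.log (Real.Gamma (1 + 1 / r) ^ r * Real.exp 1 / (1 + 1 / r))
  set ψ := min 1 (ϑ / (2 ^ r * (1 + r)) / 3) ^ 2
  have hψ : 0 < ψ := by positivity
  set C := γ + ψ / r
  have hC : 0 < C := by positivity
  set e := ψ / r * ε / 7 with he
  have he0 : 0 < e := by positivity
  set τ := r * e / ((1 + r * e) * (1 + r)) with hτ
  have hτ0 : 0 < τ := by positivity
  have hτr : τ * (1 + r) = r * e / (1 + r * e) := by rw [hτ]; field_simp
  have hτ1 : τ * (1 + r) < 1 := by rw [hτr, div_lt_one (by positivity)]; linarith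
  have hτe : 1 / r * (1 / (1 - τ * (1 + r)) - 1) = e := by
    have : 1 - τ * (1 + r) = 1 / (1 + r * e) := by rw [hτr]; field_simp; ring
    rw [this]; field_simp; ring
  obtain ⟨g, M, G, hgi, hM, hgM, hG, hη, hunif⟩ := exists_uniform_approximation
    (integrable_density hfm hf0 hμf) (show 0 < e / (C * (2 / τ + 1)) by positivity)
  have hG0 : 0 ≤ G := (abs_nonneg _).trans (hG 0)
  obtain ⟨δ, hδ, hδ1, hω⟩ := hunif (e / (C * (2 / τ * (2 * (M + 2))))) (by positivity)
  set s := min 1 (e * δ / (C * ((G + 1) * 2 * (2 * (M + 2))))) with hs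
  have hs0 : 0 < s := by positivity
  have hsmall : ∀ᶠ D in 𝓝[>] (0 : ℝ), D ≤ e * s ^ r / C :=
    nhdsWithin_le_nhds (Iic_mem_nhds (by positivity))
  have hup := eventually_RDfun_toReal_le hr hfm hf0 hμf hent hfloor he0
  refine ((hfreq e he0).and_eventually
    (((hpos.and hsmall).and hup).and self_mem_nhdsWithin)).mono ?_
  rintro D ⟨hDlt, ⟨⟨hDpos, hDs⟩, hDup⟩, hD : 0 < D⟩
  have hsum : Summable fun i => Real.negMulLog (μ ((q D).S i)).toReal := by
    by_contra h
    have h0 : (q D).entropyR μ = 0 := tsum_eq_zero_of_not_summable h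
    rw [h0] at hDpos
    have : 0 ≤ (RDfun μ (fun x => |x|) r D).toReal := ENNReal.toReal_nonneg
    linarith
  have hmain := hdev D hD τ hτ0 hτ1 hsum hgi hM hgM hG hω (by positivity) hδ hδ1 hs0
    (min_le_left _ _)
  have hlcD := hlc D hD
  rw [hτe] at hmain
  have b1 : C * ((2 / τ + 1) * ∫ x, |f x - g x|) ≤ e := by
    rw [le_div_iff₀ (by positivity)] at hη
    linarith
  have b2 : C * (2 / τ * (e / (C * (2 / τ * (2 * (M + 2)))) * (2 * (M + 2)))) = e := by
    field_simp
  have b3 : C * (G * (2 * s / δ) * (2 * (M + 2))) ≤ e := by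
    have h1 : s * (C * ((G + 1) * 2 * (2 * (M + 2)))) ≤ e * δ :=
      (le_div_iff₀ (by positivity)).1 (min_le_right _ _)
    have h2 : C * (G * (2 * s / δ) * (2 * (M + 2))) =
        s * (C * (G * 2 * (2 * (M + 2)))) / δ := by field_simp
    rw [h2, div_le_iff₀ hδ]
    refine le_trans ?_ h1
    gcongr
    linarith
  have b4 : C * (D / s ^ r) ≤ e := by
    rw [le_div_iff₀ hC] at hDs
    rw [← mul_div_assoc, div_le_iff₀ (by positivity)]
    linarith
  have b5 : C * (2 / τ * ((∫ x, |f x - g x|) +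
      e / (C * (2 / τ * (2 * (M + 2)))) * (2 * (M + 2))) +
      ((∫ x, |f x - g x|) + G * (2 * s / δ) * (2 * (M + 2)) + D / s ^ r)) ≤ 4 * e := by
    linarith
  have hfin := hmain.trans (show _ ≤ 7 * e by linarith)
  have h7 : 7 * e = ψ / r * ε := by rw [he]; ring
  rw [h7] at hfin
  have := le_of_mul_le_mul_left hfin (by positivity)
  linarith

lemma Quantizer.tsum_indicator_mem_Icc (q : Quantizer ℝ) (μ : Measure ℝ) [IsProbabilityMeasure μ]
    {I : ℤ → ℝ} (hI : ∀ i, 0 ≤ I i ∧ I i ≤ 1) : ∑' i, (μ (q.S i)).toReal * I i ∈ Icc (0 : ℝ) 1 := by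
  have h1 : ∑' i, μ (q.S i) = 1 := by
    rw [← measure_iUnion q.disj q.meas, q.cover, measure_univ]
  have h2 : ∑' i, (μ (q.S i)).toReal = 1 := by
    rw [← ENNReal.tsum_toReal_eq (by simp), h1, ENNReal.toReal_one]
  have h3 : Summable fun i => (μ (q.S i)).toReal := ENNReal.summable_toReal (by simp [h1])
  have h4 : ∀ i, (μ (q.S i)).toReal * I i ≤ (μ (q.S i)).toReal := fun i =>
    mul_le_of_le_one_right ENNReal.toReal_nonneg (hI i).2
  have h5 : ∀ i, 0 ≤ (μ (q.S i)).toReal * I i := fun i =>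
    mul_nonneg ENNReal.toReal_nonneg (hI i).1
  exact ⟨tsum_nonneg h5, h2 ▸ (h3.of_nonneg_of_le h5 h4).tsum_le_tsum h4 h3⟩

/-- Corollary 1: any family of almost-regular scalar quantizers achieving
the asymptotic excess rate must converge (in probability) to a uniform quantizer with cell
length `(2^r (1+r) D)^{1/r}` as `D ↓ 0`. -/
theorem almost_regular_optimal_quantizers_converge_to_uniform {r : ℝ} (hr : 0 < r)
    (μ : Measure ℝ) [IsProbabilityMeasure μ]
    (f : ℝ → ℝ) (hfm : Measurable f) (hf0 : ∀ x, 0 ≤ f x)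
    (hμf : μ = volume.withDensity fun x => ENNReal.ofReal (f x))
    (hent : Integrable (fun x => f x * Real.log (f x)))
    (hfloor : Summable fun k : ℤ => Real.negMulLog (μ {x | ⌊x⌋ = k}).toReal)
    (q : ℝ → Quantizer ℝ)
    (hreg : ∀ D, 0 < D → ∃ Sbar : Set ℝ, volume Sbar = 0 ∧
      ∀ i, ∃ a b : ℝ, (q D).S i \ Sbar = Set.Ico a b \ Sbar ∧ (q D).c i ∈ Set.Ico a b)
    (hdist : ∀ D, 0 < D → (q D).distortion μ (fun x => |x|) r ≤ ENNReal.ofReal D)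
    (hach : Filter.liminf
        (fun D => (q D).entropyR μ - (RDfun μ (fun x => |x|) r D).toReal) (𝓝[>] (0:ℝ))
      = (1 / r) * Real.log (Real.Gamma (1 + 1 / r) ^ r * Real.exp 1 / (1 + 1 / r)))
    (ϑ : ℝ) (hϑ : 0 < ϑ) :
    Filter.limsup (fun D => ∑' i : ℤ, (μ ((q D).S i)).toReal *
        (if |(volume ((q D).S i)).toReal ^ r / D - 2 ^ r * (1 + r)| ≤ ϑ then 1 else 0))
      (𝓝[>] (0:ℝ)) = 1 := by
  have hmem : ∀ D, ∑' i : ℤ, (μ ((q D).S i)).toReal *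
      (if |(volume ((q D).S i)).toReal ^ r / D - 2 ^ r * (1 + r)| ≤ ϑ then 1 else 0) ∈
      Icc (0 : ℝ) 1 := fun D =>
    (q D).tsum_indicator_mem_Icc μ fun i => by split_ifs <;> norm_num
  have hbdd : IsBoundedUnder (· ≤ ·) (𝓝[>] (0 : ℝ)) fun D => ∑' i : ℤ,
      (μ ((q D).S i)).toReal *
      (if |(volume ((q D).S i)).toReal ^ r / D - 2 ^ r * (1 + r)| ≤ ϑ then 1 else 0) :=
    isBoundedUnder_of ⟨1, fun D => (hmem D).2⟩
  have hcob : IsCoboundedUnder (· ≤ ·) (𝓝[>] (0 : ℝ)) fun D => ∑' i : ℤ,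
      (μ ((q D).S i)).toReal *
      (if |(volume ((q D).S i)).toReal ^ r / D - 2 ^ r * (1 + r)| ≤ ϑ then 1 else 0) :=
    (isBoundedUnder_of ⟨0, fun D => (hmem D).1⟩).isCoboundedUnder_le
  refine le_antisymm (limsup_le_of_le hcob (Eventually.of_forall fun D => (hmem D).2)) ?_
  refine le_of_forall_sub_le fun ε hε => le_limsup_of_frequently_le ?_ hbdd
  exact frequently_deviation_le hr μ f hfm hf0 hμf hent hfloor q hreg hdist hach hϑ hε

end
end

section
/- Let S ⊆ ℝ^d be a Borel set, x̂ ∈ ℝ^d, and ε, D, δ > 0. Set B_ε = {x ∈ S : ‖x − x̂‖ ≤ ε}, B̄_ε = {x ∈ S : ‖x − x̂‖ > ε}, let Λ_ε be the Lebesgue measure of B_ε, and define K_ε = Λ_ε + (r/δ^{d/r}) ∫_{B̄_ε} exp( −‖x − x̂‖^r / (Dδ) ) dx. Then K_ε ≤ Λ_ε + d·V_d·D^{d/r}·Γ(d/r, ε^r/(Dδ)) ≤ ε^d·V_d + d·V_d·D^{d/r}·Γ(d/r), where Γ(·,·) is the upper incomplete Gamma function. -/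
open MeasureTheory Filter Set
open scoped ENNReal Topology ProbabilityTheory Pointwise

noncomputable section

/-- A positive definite, absolutely homogeneous and subadditive function on a finite-dimensional
space is the pullback of the norm of a normed space under a continuous linear equivalence. -/
theorem exists_normedSpace_norm_eq {E : Type} [AddCommGroup E] [Module ℝ E]
    [FiniteDimensional ℝ E] [tE : TopologicalSpace E] [IsTopologicalAddGroup E] [T2Space E]
    [ContinuousSMul ℝ E] {g : E → ℝ} (h0 : ∀ x, g x = 0 ↔ x = 0)
    (hsmul : ∀ (c : ℝ) x, g (c • x) = |c| * g x) (hadd : ∀ x y, g (x + y) ≤ g x + g y) :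
    ∃ (F : Type) (_ : NormedAddCommGroup F) (_ : NormedSpace ℝ F) (ψ : E ≃L[ℝ] F),
      ∀ x, ‖ψ x‖ = g x := by
  let F : Type := E
  let p : AddGroupNorm F :=
    ⟨⟨g, (h0 0).2 rfl, hadd, fun x => by simpa using hsmul (-1) x⟩, fun x hx => (h0 x).1 hx⟩
  let iF : NormedAddCommGroup F := AddGroupNorm.toNormedAddCommGroup p
  let iS : NormedSpace ℝ F := { norm_smul_le := fun c x => (hsmul c x).le }
  let tF : TopologicalSpace F := UniformSpace.toTopologicalSpace
  let φ := @LinearEquiv.toContinuousLinearEquiv ℝ _ E _ _ tE _ _ F _ _ tF _ _ _ _ _ _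
    (LinearEquiv.refl ℝ E : E ≃ₗ[ℝ] F)
  exact ⟨F, iF, iS, φ, fun x => rfl⟩

theorem IsNorm.exists_normedSpace {d : ℕ} {N : (Fin d → ℝ) → ℝ} (hN : IsNorm N) :
    ∃ (F : Type) (_ : NormedAddCommGroup F) (_ : NormedSpace ℝ F)
      (ψ : (Fin d → ℝ) ≃L[ℝ] F), ∀ x, ‖ψ x‖ = N x :=
  exists_normedSpace_norm_eq hN.eq_zero_iff hN.smul hN.triangle

theorem IsNorm.continuous {d : ℕ} {N : (Fin d → ℝ) → ℝ} (hN : IsNorm N) : Continuous N := by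
  obtain ⟨F, _, _, ψ, hψ⟩ := hN.exists_normedSpace
  rw [← funext hψ]
  exact ψ.continuous.norm

/-- Integration in polar coordinates of a function of the norm `N`. -/
theorem IsNorm.integral_polar {d : ℕ} (hd : 0 < d) {N : (Fin d → ℝ) → ℝ} (hN : IsNorm N) (f : ℝ → ℝ) :
    (Integrable (fun x => f (N x)) ↔ IntegrableOn (fun y : ℝ => y ^ (d - 1) * f y) (Ioi 0)) ∧
    ∫ x, f (N x) = d * unitBallVol N * ∫ y in Ioi (0 : ℝ), y ^ (d - 1) * f y := by
  obtain ⟨F, _, _, ψ, hψ⟩ := hN.exists_normedSpace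
  borelize F
  have : FiniteDimensional ℝ F := ψ.toLinearEquiv.finiteDimensional
  have hdim : Module.finrank ℝ F = d := by
    rw [← ψ.toLinearEquiv.finrank_eq]; simp
  have : Nontrivial F := Module.nontrivial_of_finrank_pos (R := ℝ) (hdim ▸ hd)
  let e := ψ.toHomeomorph.toMeasurableEquiv
  let ν : Measure F := volume.map e
  have hν : ν.IsAddHaarMeasure := ψ.isAddHaarMeasure_map volume
  have hmp : MeasurePreserving e volume ν := e.measurable.measurePreserving _
  have he : ∀ x, ‖e x‖ = N x := hψ
  have hball : ν.real (Metric.ball 0 1) = unitBallVol N := by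
    rw [measureReal_def, ← Measure.addHaar_closedBall_eq_addHaar_ball,
      ← hmp.measure_preimage_equiv, unitBallVol]
    congr 2
    ext x
    simp [he]
  constructor
  · have h1 := hmp.integrable_comp_emb e.measurableEmbedding (g := fun y => f ‖y‖)
    have h2 := integrable_fun_norm_addHaar ν (f := f)
    rw [hdim] at h2
    simp only [Function.comp_def, he] at h1
    simpa only [smul_eq_mul] using h1.trans h2
  · have h1 := hmp.integral_comp' (g := fun y => f ‖y‖)
    have h2 := integral_fun_norm_addHaar ν f
    simp only [he] at h1
    rw [h1, h2, hdim, hball]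
    simp [mul_assoc]

theorem IsNorm.volume_le {d : ℕ} (hd : 0 < d) {N : (Fin d → ℝ) → ℝ} (hN : IsNorm N)
    (xhat : Fin d → ℝ) {ε : ℝ} (hε : 0 < ε) :
    volume {x | N (x - xhat) ≤ ε} ≠ ⊤ ∧
      (volume {x | N (x - xhat) ≤ ε}).toReal = ε ^ d * unitBallVol N := by
  have htr : volume {x | N (x - xhat) ≤ ε} = volume {x | N x ≤ ε} := by
    simpa only [sub_eq_add_neg, preimage_ofPred_eq] using
      measure_preimage_add_right volume (-xhat) {x | N x ≤ ε}
  have hpol := hN.integral_polar hd ((Iic ε).indicator fun _ => 1)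
  have hmeas : MeasurableSet {x | N x ≤ ε} := hN.continuous.measurable measurableSet_Iic
  have hind : (fun x => (Iic ε).indicator (fun _ => (1 : ℝ)) (N x)) =
      {x | N x ≤ ε}.indicator fun _ => 1 := by
    ext x; simp [indicator]
  have hind' : (fun y : ℝ => y ^ (d - 1) * (Iic ε).indicator (fun _ => (1 : ℝ)) y) =
      (Iic ε).indicator fun y => y ^ (d - 1) := by
    ext x; simp [indicator]
  have hset : Ioi 0 ∩ Iic ε = Ioc 0 ε := rfl
  rw [hind, hind', integrable_indicator_iff hmeas, integral_indicator hmeas,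
    setIntegral_indicator measurableSet_Iic, hset, ← intervalIntegral.integral_of_le hε.le,
    integral_pow] at hpol
  rw [htr]
  constructor
  · have h : IntegrableOn (fun _ => (1 : ℝ)) {x | N x ≤ ε} := by
      refine hpol.1.2 ?_
      rw [IntegrableOn, integrable_indicator_iff measurableSet_Iic, IntegrableOn,
        Measure.restrict_restrict measurableSet_Iic, inter_comm, hset]
      exact (intervalIntegral.intervalIntegrable_pow (d - 1)).1
    rw [integrableOn_const_iff] at h
    exact (h.resolve_left (by simp)).ne
  · have h := hpol.2
    have hd' : (d : ℝ) ≠ 0 := by positivity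
    have hd1 : ((d - 1 : ℕ) : ℝ) + 1 = d := by exact_mod_cast Nat.sub_add_cancel hd
    rw [setIntegral_const, Nat.sub_add_cancel hd, hd1, zero_pow hd.ne', measureReal_def] at h
    simp only [smul_eq_mul, mul_one] at h
    rw [h]
    field_simp
    ring

/-- Substitution `ξ = y ^ r / c` in the incomplete Gamma integral. -/
theorem integral_Ioi_pow_mul_exp_neg_rpow_div {d : ℕ} (hd : 0 < d) {r ε c : ℝ} (hr : 0 < r)
    (hε : 0 ≤ ε) (hc : 0 < c) :
    ∫ y in Ioi ε, y ^ (d - 1) * Real.exp (-(y ^ r) / c) =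
      c ^ ((d : ℝ) / r) / r * uGamma ((d : ℝ) / r) (ε ^ r / c) := by
  have h1 := integral_comp_mul_left_Ioi' (fun ξ : ℝ => ξ ^ ((d : ℝ) / r - 1) * Real.exp (-ξ))
    (ε ^ r) (inv_pos.2 hc)
  have h2 := integral_comp_rpow_Ioi_of_pos'
    (g := fun x : ℝ => (c⁻¹ * x) ^ ((d : ℝ) / r - 1) * Real.exp (-(c⁻¹ * x)))
    hr (Real.rpow_nonneg hε r)
  rw [uGamma, div_eq_inv_mul (ε ^ r), ← h1, ← h2, Real.rpow_rpow_inv hε hr.ne', smul_eq_mul,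
    ← integral_const_mul, ← integral_const_mul]
  refine setIntegral_congr_fun measurableSet_Ioi fun y hy => ?_
  have hy : 0 < y := hε.trans_lt hy
  have e1 : y ^ (d - 1) = y ^ (r - 1) * (y ^ r) ^ ((d : ℝ) / r - 1) := by
    rw [← Real.rpow_mul hy.le, ← Real.rpow_add hy, ← Real.rpow_natCast, Nat.cast_sub hd]
    congr 1
    field_simp
    push_cast
    ring
  have e2 : c ^ ((d : ℝ) / r) * (c⁻¹) ^ ((d : ℝ) / r - 1) * c⁻¹ = 1 := by
    rw [mul_assoc, ← Real.rpow_add_one (inv_pos.2 hc).ne', sub_add_cancel,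
      ← Real.mul_rpow hc.le (inv_pos.2 hc).le, mul_inv_cancel₀ hc.ne', Real.one_rpow]
  have e3 : -(y ^ r) / c = -(c⁻¹ * y ^ r) := by field_simp
  simp only [smul_eq_mul]
  rw [Real.mul_rpow (inv_pos.2 hc).le (Real.rpow_nonneg hy.le r), e1, e3]
  calc _ = (c ^ ((d : ℝ) / r) * (c⁻¹) ^ ((d : ℝ) / r - 1) * c⁻¹) * (r / r) *
        (y ^ (r - 1) * (y ^ r) ^ ((d : ℝ) / r - 1) * Real.exp (-(c⁻¹ * y ^ r))) := by
        rw [e2, div_self hr.ne', one_mul, one_mul]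
    _ = _ := by ring

theorem uGamma_le_Gamma {s a : ℝ} (hs : 0 < s) (ha : 0 ≤ a) : uGamma s a ≤ Real.Gamma s := by
  rw [uGamma, Real.Gamma_eq_integral hs]
  simp_rw [mul_comm (_ ^ (s - 1))]
  refine setIntegral_mono_set (Real.GammaIntegral_convergent hs) ?_
    (Ioi_subset_Ioi ha).eventuallyLE
  filter_upwards [ae_restrict_mem measurableSet_Ioi] with x hx
  have : 0 < x := hx
  positivity

theorem IsNorm.integral_exp_neg_rpow_div {d : ℕ} (hd : 0 < d) {N : (Fin d → ℝ) → ℝ}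
    (hN : IsNorm N) (xhat : Fin d → ℝ) {r ε c : ℝ} (hr : 0 < r) (hε : 0 ≤ ε) (hc : 0 < c) :
    IntegrableOn (fun x => Real.exp (-(N (x - xhat) ^ r) / c)) {x | ε < N (x - xhat)} ∧
    ∫ x in {x | ε < N (x - xhat)}, Real.exp (-(N (x - xhat) ^ r) / c) =
      d * unitBallVol N * (c ^ ((d : ℝ) / r) / r * uGamma ((d : ℝ) / r) (ε ^ r / c)) := by
  let f : ℝ → ℝ := (Ioi ε).indicator fun t => Real.exp (-(t ^ r) / c)
  have hmeas : MeasurableSet {x | ε < N (x - xhat)} :=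
    (hN.continuous.comp (continuous_sub_right xhat)).measurable measurableSet_Ioi
  have hind : {x | ε < N (x - xhat)}.indicator (fun x => Real.exp (-(N (x - xhat) ^ r) / c)) =
      fun x => f (N (x - xhat)) := by
    ext x; simp [f, indicator]
  have hind' : (fun y : ℝ => y ^ (d - 1) * f y) =
      (Ioi ε).indicator fun y => y ^ (d - 1) * Real.exp (-(y ^ r) / c) := by
    ext x; simp [f, indicator]
  have hpol := hN.integral_polar hd f
  have hset : Ioi 0 ∩ Ioi ε = Ioi ε := inter_eq_right.2 (Ioi_subset_Ioi hε)
  rw [hind', setIntegral_indicator measurableSet_Ioi, hset,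
    integral_Ioi_pow_mul_exp_neg_rpow_div hd hr hε hc] at hpol
  rw [← integrable_indicator_iff hmeas, ← integral_indicator hmeas, hind,
    integral_sub_right_eq_self (fun x => f (N x))]
  refine ⟨(hpol.1.2 ?_).comp_sub_right xhat, hpol.2⟩
  refine IntegrableOn.indicator ?_ measurableSet_Ioi
  have hpos : (-1 : ℝ) < (d - 1 : ℕ) := by
    have : (0 : ℝ) ≤ (d - 1 : ℕ) := Nat.cast_nonneg _
    linarith
  refine (integrableOn_rpow_mul_exp_neg_mul_rpow hpos hr (inv_pos.2 hc)).congr_fun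
    (fun y _ => ?_) measurableSet_Ioi
  simp only [Real.rpow_natCast]
  congr 2
  field_simp

/-- Lemma 2: upper bounds on the normalizing constant `K_ε`. -/
theorem normalizing_constant_upper_bound {d : ℕ} (hd : 0 < d) {r : ℝ} (hr : 0 < r)
    {N : (Fin d → ℝ) → ℝ} (hN : IsNorm N)
    (S : Set (Fin d → ℝ)) (hS : MeasurableSet S) (xhat : Fin d → ℝ)
    (ε D δ : ℝ) (hε : 0 < ε) (hD : 0 < D) (hδ : 0 < δ) :
    (volume {x | x ∈ S ∧ N (x - xhat) ≤ ε}).toReal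
        + (r / δ ^ ((d : ℝ) / r)) *
          ∫ x in {x | x ∈ S ∧ ε < N (x - xhat)}, Real.exp (-(N (x - xhat) ^ r) / (D * δ))
      ≤ (volume {x | x ∈ S ∧ N (x - xhat) ≤ ε}).toReal
        + d * unitBallVol N * D ^ ((d : ℝ) / r) * uGamma ((d : ℝ) / r) (ε ^ r / (D * δ))
    ∧ (volume {x | x ∈ S ∧ N (x - xhat) ≤ ε}).toReal
        + d * unitBallVol N * D ^ ((d : ℝ) / r) * uGamma ((d : ℝ) / r) (ε ^ r / (D * δ))
      ≤ ε ^ d * unitBallVol N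
        + d * unitBallVol N * D ^ ((d : ℝ) / r) * Real.Gamma ((d : ℝ) / r) := by
  have hVnn : 0 ≤ unitBallVol N := ENNReal.toReal_nonneg
  have hDd : 0 < D * δ := mul_pos hD hδ
  constructor
  · refine add_le_add le_rfl ?_
    obtain ⟨hint, hval⟩ := hN.integral_exp_neg_rpow_div hd xhat hr hε.le hDd
    have hle : ∫ x in {x | x ∈ S ∧ ε < N (x - xhat)}, Real.exp (-(N (x - xhat) ^ r) / (D * δ)) ≤
        ∫ x in {x | ε < N (x - xhat)}, Real.exp (-(N (x - xhat) ^ r) / (D * δ)) :=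
      setIntegral_mono_set hint (Eventually.of_forall fun x => (Real.exp_pos _).le)
        (show {x | x ∈ S ∧ ε < N (x - xhat)} ⊆ _ from fun x hx => hx.2).eventuallyLE
    refine (mul_le_mul_of_nonneg_left hle (by positivity)).trans_eq ?_
    rw [hval, Real.mul_rpow hD.le hδ.le]
    have : δ ^ ((d : ℝ) / r) ≠ 0 := by positivity
    field_simp
  · obtain ⟨hfin, hval⟩ := hN.volume_le hd xhat hε
    have hG := uGamma_le_Gamma (s := (d : ℝ) / r) (a := ε ^ r / (D * δ)) (by positivity)
      (by positivity)
    gcongr ?_ + _ * ?_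
    rw [← hval]
    exact ENNReal.toReal_mono hfin (measure_mono fun x hx => hx.2)

end
end
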